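/- arXiv:2212.12312 — 2 statements merged into one kernel-verified Lean document; each statement's English description precedes it below -/
import Mathlib

section
/- Let FQ^s be the s-dimensional folded hypercube and let p ≤ 2^{s−1}. Let P = L_p = {0, 1, …, p − 1}. Let P₁ and P₂ be disjoint sets of consecutive integers (intervals), each contained entirely within {0, 1, …, 2^{s−1} − 1} or entirely within {2^{s−1}, …, 2^s − 1}, with |P₁| + |P₂| = p. Then the number of edges of FQ^s with both endpoints in P₁ ∪ P₂ is at most the number of edges of FQ^s with both endpoints in P. -/
open scoped Classical

/-- Number of edges of `G` with both endpoints in `S`. -/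
noncomputable def interiorCount {V : Type*} [Fintype V] (G : SimpleGraph V)
    (S : Finset V) : ℕ :=
  (G.edgeFinset.filter (fun e => ∀ v ∈ e, v ∈ S)).card

/-- The `s`-dimensional folded hypercube `FQ^s`, with vertices identified with
the integers `0, 1, …, 2^s − 1` via binary representation: two vertices are
adjacent iff they differ in exactly one coordinate (bitwise xor a power of two
`2^i`, `i < s`) or in all `s` coordinates (bitwise xor equal to `2^s − 1`). -/
def foldedHypercube (s : ℕ) : SimpleGraph (Fin (2 ^ s)) :=
  SimpleGraph.fromRel
    (fun u v => (∃ i < s, u.val ^^^ v.val = 2 ^ i) ∨ u.val ^^^ v.val = 2 ^ s - 1)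

/-- `P` is a set of consecutive integers (an interval). -/
def IsIntervalSet {s : ℕ} (P : Finset (Fin (2 ^ s))) : Prop :=
  ∃ a b : ℕ, ∀ v : Fin (2 ^ s), v ∈ P ↔ a ≤ v.val ∧ v.val < b

/-- `P` lies entirely in one of the two subcubes `0Q^{s−1}`, `1Q^{s−1}`. -/
def InOneSubcube {s : ℕ} (P : Finset (Fin (2 ^ s))) : Prop :=
  (∀ v ∈ P, (v : Fin (2 ^ s)).val < 2 ^ (s - 1)) ∨
    (∀ v ∈ P, 2 ^ (s - 1) ≤ (v : Fin (2 ^ s)).val)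

/-- The number of edges of the hypercube induced by `{0, …, n - 1}`. -/
def initialEdges (n : ℕ) : ℕ := ∑ i ∈ Finset.range n, i.bitIndices.length

theorem initialEdges_two_mul (n : ℕ) : initialEdges (2 * n) = 2 * initialEdges n + n := by
  induction n with
  | zero => rfl
  | succ n ih =>
    have h : 2 * (n + 1) = 2 * n + 1 + 1 := by ring
    simp only [initialEdges] at *
    rw [h, Finset.sum_range_succ, Finset.sum_range_succ, ih, Finset.sum_range_succ]
    simp
    ring

theorem initialEdges_two_mul_add_one (n : ℕ) :
    initialEdges (2 * n + 1) = initialEdges n + initialEdges (n + 1) + n := by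
  have h := initialEdges_two_mul n
  simp only [initialEdges] at *
  rw [Finset.sum_range_succ, h, Finset.sum_range_succ]
  simp
  ring

theorem initialEdges_add_min_le (a b : ℕ) :
    initialEdges a + initialEdges b + min a b ≤ initialEdges (a + b) := by
  induction h : a + b using Nat.strong_induction_on generalizing a b with
  | _ n ih =>
    subst h
    rcases Nat.eq_zero_or_pos a with rfl | ha
    · simp [initialEdges]
    rcases Nat.eq_zero_or_pos b with rfl | hb
    · simp [initialEdges]
    obtain ⟨x, rfl | rfl⟩ := Nat.even_or_odd' a <;> obtain ⟨y, rfl | rfl⟩ := Nat.even_or_odd' b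
    · have h := ih _ (by omega) x y rfl
      rw [show 2 * x + 2 * y = 2 * (x + y) by ring]
      simp only [initialEdges_two_mul]
      omega
    · have h₁ := ih _ (by omega) x y rfl
      have h₂ := ih _ (by omega) x (y + 1) rfl
      rw [show 2 * x + (2 * y + 1) = 2 * (x + y) + 1 by ring]
      simp only [initialEdges_two_mul, initialEdges_two_mul_add_one, ← add_assoc] at *
      omega
    · have h₁ := ih _ (by omega) x y rfl
      have h₂ := ih _ (by omega) (x + 1) y rfl
      rw [show 2 * x + 1 + 2 * y = 2 * (x + y) + 1 by ring]
      rw [show x + 1 + y = x + y + 1 by ring] at h₂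
      simp only [initialEdges_two_mul, initialEdges_two_mul_add_one] at *
      omega
    · rcases Nat.eq_zero_or_pos (x + y) with h0 | h0
      · obtain ⟨rfl, rfl⟩ : x = 0 ∧ y = 0 := by omega
        decide
      have h₁ := ih _ (by omega) x (y + 1) rfl
      have h₂ := ih _ (by omega) (x + 1) y rfl
      rw [show 2 * x + 1 + (2 * y + 1) = 2 * (x + y + 1) by ring]
      rw [show x + 1 + y = x + y + 1 by ring] at h₂
      simp only [initialEdges_two_mul, initialEdges_two_mul_add_one, ← add_assoc] at *
      omega

theorem initialEdges_two_pow_sub (k x : ℕ) (hx : x ≤ 2 ^ k) :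
    initialEdges (2 ^ k - x) + k * x = initialEdges (2 ^ k) + initialEdges x := by
  induction k generalizing x with
  | zero =>
    obtain rfl | rfl : x = 0 ∨ x = 1 := by simp at hx; omega
    all_goals decide
  | succ k ih =>
    rw [pow_succ'] at *
    rw [initialEdges_two_mul]
    obtain ⟨y, rfl | rfl⟩ := Nat.even_or_odd' x
    · have h := ih y (by omega)
      rw [← Nat.mul_sub, initialEdges_two_mul, initialEdges_two_mul,
        show (k + 1) * (2 * y) = 2 * (k * y) + 2 * y by ring]
      omega
    · have h₁ := ih y (by omega)
      have h₂ := ih (y + 1) (by omega)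
      have e₁ : 2 * 2 ^ k - (2 * y + 1) = 2 * (2 ^ k - (y + 1)) + 1 := by omega
      have e₂ : 2 ^ k - (y + 1) + 1 = 2 ^ k - y := by omega
      rw [e₁, initialEdges_two_mul_add_one, initialEdges_two_mul_add_one, e₂,
        show (k + 1) * (2 * y + 1) = k * y + k * (y + 1) + 2 * y + 1 by ring]
      omega

theorem initialEdges_add_add_min_le {k x y : ℕ} (h : x + y ≤ 2 ^ k) :
    initialEdges (x + y) + initialEdges y + min y (2 ^ k - (x + y)) ≤ initialEdges x + k * y := by
  have h₁ := initialEdges_two_pow_sub k (x + y) h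
  have h₂ := initialEdges_two_pow_sub k x (by omega)
  have h₃ := initialEdges_add_min_le y (2 ^ k - (x + y))
  rw [show y + (2 ^ k - (x + y)) = 2 ^ k - x by omega] at h₃
  rw [mul_add] at h₁
  omega

/-- Blocks of sizes `a₀, b₀, a₁, b₁` joined cyclically by matchings. -/
theorem initialEdges_four_cycle_le (a₀ a₁ b₀ b₁ : ℕ) :
    initialEdges a₀ + initialEdges a₁ + initialEdges b₀ + initialEdges b₁ +
      (min a₀ b₀ + min a₁ b₁ + min a₀ b₁ + min a₁ b₀) ≤
      initialEdges (a₀ + a₁ + (b₀ + b₁)) := by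
  have h₁ := initialEdges_add_min_le a₀ b₀
  have h₂ := initialEdges_add_min_le a₁ b₁
  have h₃ := initialEdges_add_min_le (a₀ + b₀) (a₁ + b₁)
  rw [show a₀ + b₀ + (a₁ + b₁) = a₀ + a₁ + (b₀ + b₁) by ring] at h₃
  omega

/-- The blocks of sizes `a₀` and `a₁` are moreover joined by `a₀ + a₁ - 2 ^ k` edges. -/
theorem initialEdges_four_cycle_add_le_of_le {k a₀ a₁ b₀ b₁ : ℕ} (ha₀ : a₀ ≤ 2 ^ k)
    (ha₁ : a₁ ≤ 2 ^ k) (ha : 2 ^ k ≤ a₀ + a₁)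
    (h : a₀ + a₁ + (b₀ + b₁) ≤ 2 * 2 ^ k) :
    initialEdges a₀ + initialEdges a₁ + initialEdges b₀ + initialEdges b₁ +
      (a₀ + a₁ - 2 ^ k) + (min a₀ b₀ + min a₁ b₁ + min a₀ b₁ + min a₁ b₀) ≤
      initialEdges (a₀ + a₁ + (b₀ + b₁)) := by
  obtain ⟨c₀, hc₀⟩ := Nat.exists_eq_add_of_le ha₀
  obtain ⟨c₁, hc₁⟩ := Nat.exists_eq_add_of_le ha₁
  obtain ⟨d, hd⟩ : ∃ d, c₀ + c₁ = d + (b₀ + b₁) := ⟨c₀ + c₁ - (b₀ + b₁), by omega⟩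
  have h₁ := initialEdges_two_pow_sub k c₀ (by omega)
  have h₂ := initialEdges_two_pow_sub k c₁ (by omega)
  have h₃ := initialEdges_two_pow_sub (k + 1) d (by rw [pow_succ']; omega)
  have h₄ := initialEdges_add_min_le c₀ c₁
  have h₅ := initialEdges_add_min_le b₀ b₁
  have h₆ := initialEdges_add_add_min_le (k := k) (x := d) (y := b₀ + b₁) (by omega)
  rw [pow_succ', initialEdges_two_mul,
    show 2 * 2 ^ k - d = a₀ + a₁ + (b₀ + b₁) by omega] at h₃
  rw [show 2 ^ k - c₀ = a₀ by omega] at h₁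
  rw [show 2 ^ k - c₁ = a₁ by omega] at h₂
  have h₇ : k * c₀ + k * c₁ = k * d + k * (b₀ + b₁) := by rw [← mul_add, hd, mul_add]
  rw [add_one_mul] at h₃
  rw [hd] at h₄
  have key : min a₀ b₀ + min a₁ b₁ + min a₀ b₁ + min a₁ b₀ ≤
    b₀ + b₁ + min b₀ b₁ + min c₀ c₁ + min (b₀ + b₁) (2 ^ k - (d + (b₀ + b₁))) := by omega
  omega

theorem initialEdges_four_cycle_add_le {k a₀ a₁ b₀ b₁ : ℕ} (ha₀ : a₀ ≤ 2 ^ k)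
    (ha₁ : a₁ ≤ 2 ^ k) (hb₀ : b₀ ≤ 2 ^ k) (hb₁ : b₁ ≤ 2 ^ k)
    (h : a₀ + a₁ + (b₀ + b₁) ≤ 2 * 2 ^ k) :
    initialEdges a₀ + initialEdges a₁ + initialEdges b₀ + initialEdges b₁ +
      (a₀ + a₁ - 2 ^ k) + (b₀ + b₁ - 2 ^ k) +
      (min a₀ b₀ + min a₁ b₁ + min a₀ b₁ + min a₁ b₀) ≤
      initialEdges (a₀ + a₁ + (b₀ + b₁)) := by
  rcases le_total (2 ^ k) (a₀ + a₁) with ha | ha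
  · have := initialEdges_four_cycle_add_le_of_le ha₀ ha₁ ha h
    omega
  rcases le_total (2 ^ k) (b₀ + b₁) with hb | hb
  · have := initialEdges_four_cycle_add_le_of_le hb₀ hb₁ hb (by omega : b₀ + b₁ + (a₀ + a₁) ≤ _)
    rw [add_comm (b₀ + b₁)] at this
    omega
  have := initialEdges_four_cycle_le a₀ a₁ b₀ b₁
  omega

/-- The number of pairs in `A × B` related by `R`. -/
noncomputable def crossCount {V : Type*} (R : V → V → Prop) (A B : Finset V) : ℕ :=
  ((A ×ˢ B).filter fun q => R q.1 q.2).card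

/-- The number of increasing pairs in `S` related by `R`. -/
noncomputable def edgeCount {V : Type*} [LinearOrder V] (R : V → V → Prop) (S : Finset V) : ℕ :=
  crossCount (fun u v => u < v ∧ R u v) S S

theorem interiorCount_eq_edgeCount {V : Type*} [Fintype V] [LinearOrder V] (G : SimpleGraph V)
    (S : Finset V) : interiorCount G S = edgeCount G.Adj S := by
  refine (Finset.card_nbij (fun q => s(q.1, q.2)) ?_ ?_ ?_).symm
  · rintro ⟨u, v⟩ h
    simp_all
  · rintro ⟨u, v⟩ h ⟨u', v'⟩ h' e
    simp only [Finset.coe_filter, Finset.mem_product, Set.mem_ofPred_eq, Sym2.eq_iff] at h h' e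
    rcases e with ⟨rfl, rfl⟩ | ⟨rfl, rfl⟩
    · rfl
    · exact absurd h.2.1 h'.2.1.asymm
  · intro e h
    induction e with
    | _ u v =>
      simp only [Finset.coe_filter, SimpleGraph.mem_edgeFinset, SimpleGraph.mem_edgeSet,
        Sym2.mem_iff, forall_eq_or_imp, forall_eq, Set.mem_ofPred_eq] at h
      rcases lt_or_gt_of_ne h.1.ne with hlt | hlt
      · exact ⟨(u, v), by simp [h, hlt], rfl⟩
      · exact ⟨(v, u), by simp [h, hlt, h.1.symm], Sym2.eq_swap⟩

theorem crossCount_mono {V : Type*} {R R' : V → V → Prop} {A B : Finset V}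
    (h : ∀ u ∈ A, ∀ v ∈ B, R u v → R' u v) : crossCount R A B ≤ crossCount R' A B := by
  refine Finset.card_le_card fun q hq => ?_
  simp only [Finset.mem_filter, Finset.mem_product] at hq ⊢
  exact ⟨hq.1, h _ hq.1.1 _ hq.1.2 hq.2⟩

theorem crossCount_eq_zero {V : Type*} {R : V → V → Prop} {A B : Finset V}
    (h : ∀ u ∈ A, ∀ v ∈ B, ¬ R u v) : crossCount R A B = 0 := by
  simp only [crossCount, Finset.card_eq_zero, Finset.filter_eq_empty_iff, Finset.mem_product]
  exact fun q hq => h _ hq.1 _ hq.2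

theorem crossCount_union_left_le {V : Type*} [DecidableEq V] (R : V → V → Prop)
    (A A' B : Finset V) :
    crossCount R (A ∪ A') B ≤ crossCount R A B + crossCount R A' B := by
  rw [crossCount, Finset.union_product, Finset.filter_union]
  exact Finset.card_union_le _ _

theorem crossCount_union_right_le {V : Type*} [DecidableEq V] (R : V → V → Prop)
    (A B B' : Finset V) :
    crossCount R A (B ∪ B') ≤ crossCount R A B + crossCount R A B' := by
  rw [crossCount, Finset.product_union, Finset.filter_union]
  exact Finset.card_union_le _ _

theorem edgeCount_mono {V : Type*} [LinearOrder V] {R R' : V → V → Prop} {S : Finset V}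
    (h : ∀ u ∈ S, ∀ v ∈ S, R u v → R' u v) : edgeCount R S ≤ edgeCount R' S :=
  crossCount_mono fun u hu v hv hR => ⟨hR.1, h u hu v hv hR.2⟩

theorem edgeCount_union_le {V : Type*} [LinearOrder V] (R : V → V → Prop) {A B : Finset V}
    (h : ∀ u ∈ A, ∀ v ∈ B, u < v) :
    edgeCount R (A ∪ B) ≤ edgeCount R A + edgeCount R B + crossCount R A B := by
  have h₁ := crossCount_union_left_le (fun u v => u < v ∧ R u v) A B (A ∪ B)
  have h₂ := crossCount_union_right_le (fun u v => u < v ∧ R u v) A A B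
  have h₃ := crossCount_union_right_le (fun u v => u < v ∧ R u v) B A B
  have h₄ : crossCount (fun u v => u < v ∧ R u v) B A = 0 :=
    crossCount_eq_zero fun u hu v hv hR => (h v hv u hu).asymm hR.1
  have h₅ : crossCount (fun u v => u < v ∧ R u v) A B ≤ crossCount R A B :=
    crossCount_mono fun _ _ _ _ hR => hR.2
  simp only [edgeCount] at *
  omega

/-- A relation of the form `u ^^^ v = m` is a matching. -/
theorem crossCount_le_min {R : ℕ → ℕ → Prop} {A B : Finset ℕ} (m : ℕ)
    (h : ∀ u ∈ A, ∀ v ∈ B, R u v → u ^^^ v = m) :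
    crossCount R A B ≤ min A.card B.card := by
  refine le_min (Finset.card_le_card_of_injOn Prod.fst ?_ ?_)
    (Finset.card_le_card_of_injOn Prod.snd ?_ ?_)
  · intro q hq
    simp_all
  · rintro ⟨u, v⟩ hq ⟨u', v'⟩ hq' e
    simp only [Finset.coe_filter, Finset.mem_product, Set.mem_ofPred_eq] at hq hq' e
    subst e
    have := (h _ hq.1.1 _ hq.1.2 hq.2).trans (h _ hq'.1.1 _ hq'.1.2 hq'.2).symm
    rw [Nat.xor_right_injective this]
  · intro q hq
    simp_all
  · rintro ⟨u, v⟩ hq ⟨u', v'⟩ hq' e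
    simp only [Finset.coe_filter, Finset.mem_product, Set.mem_ofPred_eq] at hq hq' e
    subst e
    have := (h _ hq.1.1 _ hq.1.2 hq.2).trans (h _ hq'.1.1 _ hq'.1.2 hq'.2).symm
    rw [Nat.xor_left_injective this]

/-- Adjacency in the infinite-dimensional hypercube on `ℕ`. -/
def CubeAdj (u v : ℕ) : Prop := ∃ i, u ^^^ v = 2 ^ i

/-- Adjacency in the folded hypercube, for the underlying natural numbers. -/
def FoldedAdj (s u v : ℕ) : Prop := CubeAdj u v ∨ u ^^^ v = 2 ^ s - 1

theorem CubeAdj.xor_eq {u v k j : ℕ} (h : CubeAdj u v)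
    (hj : u / 2 ^ k ^^^ v / 2 ^ k = 2 ^ j) : u ^^^ v = 2 ^ (k + j) := by
  obtain ⟨i, hi⟩ := h
  rw [← Nat.xor_div_two_pow, hi] at hj
  rcases lt_or_ge i k with hik | hik
  · rw [Nat.div_eq_of_lt (Nat.pow_lt_pow_right (by norm_num) hik)] at hj
    exact absurd hj (by positivity)
  · rw [Nat.pow_div hik (by norm_num)] at hj
    rw [hi, ← Nat.pow_right_injective le_rfl hj, Nat.add_sub_cancel' hik]

theorem not_cubeAdj_of_xor_div_eq_three {u v k : ℕ} (hj : u / 2 ^ k ^^^ v / 2 ^ k = 3) :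
    ¬ CubeAdj u v := by
  rintro ⟨i, hi⟩
  rw [← Nat.xor_div_two_pow, hi] at hj
  rcases lt_or_ge i k with hik | hik
  · rw [Nat.div_eq_of_lt (Nat.pow_lt_pow_right (by norm_num) hik)] at hj
    omega
  · rw [Nat.pow_div hik (by norm_num)] at hj
    rcases Nat.eq_zero_or_pos (i - k) with h | h
    · simp [h] at hj
    · have := (Nat.even_pow.2 ⟨even_two, h.ne'⟩ : Even (2 ^ (i - k)))
      rw [hj] at this
      exact absurd this (by decide)

theorem two_mul_xor_two_mul_add_one (c : ℕ) : 2 * c ^^^ (2 * c + 1) = 1 := by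
  have : 2 * c + 1 = 2 * c ^^^ 1 := by
    rw [Nat.xor_one_of_even (even_two_mul c)]
  rw [this, Nat.xor_xor_cancel_left]

/-- Edge-isoperimetry in the subcube of numbers with given leading digits. -/
theorem edgeCount_cubeAdj_le (k c : ℕ) (S : Finset ℕ) (h : ∀ u ∈ S, u / 2 ^ k = c) :
    edgeCount CubeAdj S ≤ initialEdges S.card := by
  induction k generalizing c S with
  | zero =>
    refine le_of_eq_of_le (crossCount_eq_zero fun u hu v hv hR => ?_) (Nat.zero_le _)
    have := h u hu
    have := h v hv
    simp only [pow_zero, Nat.div_one] at *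
    omega
  | succ k ih =>
    have hdiv : ∀ u ∈ S, u / 2 ^ k = 2 * c ∨ u / 2 ^ k = 2 * c + 1 := fun u hu => by
      have := h u hu
      rw [pow_succ, ← Nat.div_div_eq_div_mul] at this
      omega
    set A := S.filter fun u => u / 2 ^ k = 2 * c with hA
    set B := S.filter fun u => u / 2 ^ k = 2 * c + 1 with hB
    have hS : S = A ∪ B := by
      ext u
      simp only [hA, hB, Finset.mem_union, Finset.mem_filter]
      have := hdiv u
      tauto
    have hA' : ∀ u ∈ A, u / 2 ^ k = 2 * c := fun u hu => (Finset.mem_filter.1 hu).2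
    have hB' : ∀ u ∈ B, u / 2 ^ k = 2 * c + 1 := fun u hu => (Finset.mem_filter.1 hu).2
    have hlt : ∀ u ∈ A, ∀ v ∈ B, u < v := fun u hu v hv => by
      by_contra! hle
      have := Nat.div_le_div_right (c := 2 ^ k) hle
      rw [hA' u hu, hB' v hv] at this
      omega
    have hcross : crossCount CubeAdj A B ≤ min A.card B.card :=
      crossCount_le_min (2 ^ (k + 0)) fun u hu v hv hR => hR.xor_eq <| by
        rw [hA' u hu, hB' v hv, two_mul_xor_two_mul_add_one, pow_zero]
    have hcard : S.card = A.card + B.card := by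
      rw [hS]
      exact Finset.card_union_of_disjoint
        (Finset.disjoint_left.2 fun u hu hu' => (hlt u hu u hu').false)
    have h₁ := edgeCount_union_le CubeAdj hlt
    have h₂ := ih _ A hA'
    have h₃ := ih _ B hB'
    have h₄ := initialEdges_add_min_le A.card B.card
    rw [← hcard] at h₄
    rw [← hS] at h₁
    omega

/-- In an interval of length `ℓ`, at most `ℓ - 2 ^ k` pairs are at distance `2 ^ k`. -/
theorem crossCount_cubeAdj_le_sub {x y k c : ℕ} {A B : Finset ℕ}
    (hA : A ⊆ Finset.Ico x y) (hB : B ⊆ Finset.Ico x y)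
    (hA' : ∀ u ∈ A, u / 2 ^ k = 2 * c) (hB' : ∀ u ∈ B, u / 2 ^ k = 2 * c + 1) :
    crossCount CubeAdj A B ≤ y - x - 2 ^ k := by
  have hxor : ∀ u ∈ A, ∀ v ∈ B, CubeAdj u v → v = u + 2 ^ k := fun u hu v hv hR => by
    have h : u ^^^ v = 2 ^ (k + 0) := hR.xor_eq <| by
      rw [hA' u hu, hB' v hv, two_mul_xor_two_mul_add_one, pow_zero]
    have hmod : u % 2 ^ k ^^^ v % 2 ^ k = 0 := by
      rw [← Nat.xor_mod_two_pow, h, add_zero, Nat.mod_self]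
    rw [Nat.xor_eq_zero_iff] at hmod
    rw [← Nat.div_add_mod u (2 ^ k), ← Nat.div_add_mod v (2 ^ k), hA' u hu, hB' v hv, hmod]
    ring
  calc crossCount CubeAdj A B ≤ (Finset.Ico x (y - 2 ^ k)).card := by
        refine Finset.card_le_card_of_injOn Prod.fst ?_ ?_
        · rintro ⟨u, v⟩ hq
          simp only [Finset.coe_filter, Finset.mem_product, Set.mem_ofPred_eq] at hq
          have h₁ := Finset.mem_Ico.1 (hA hq.1.1)
          have h₂ := Finset.mem_Ico.1 (hB hq.1.2)
          have := hxor _ hq.1.1 _ hq.1.2 hq.2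
          simp only [Finset.coe_Ico, Set.mem_Ico]
          omega
        · rintro ⟨u, v⟩ hq ⟨u', v'⟩ hq' e
          simp only [Finset.coe_filter, Finset.mem_product, Set.mem_ofPred_eq] at hq hq' e
          rw [hxor _ hq.1.1 _ hq.1.2 hq.2, hxor _ hq'.1.1 _ hq'.1.2 hq'.2, e]
    _ = y - x - 2 ^ k := by rw [Nat.card_Ico]; omega

theorem initialEdges_le_edgeCount_range (p : ℕ) :
    initialEdges p ≤ edgeCount CubeAdj (Finset.range p) := by
  have : initialEdges p =
      ((Finset.range p).sigma fun v => v.bitIndices.toFinset).card := by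
    rw [Finset.card_sigma, initialEdges]
    exact Finset.sum_congr rfl fun v _ => (List.toFinset_card_of_nodup Nat.bitIndices_nodup).symm
  rw [this]
  refine Finset.card_le_card_of_injOn (fun q => (q.1 ^^^ 2 ^ q.2, q.1)) ?_ ?_
  · rintro ⟨v, i⟩ hq
    simp only [Finset.coe_sigma, Set.mem_sigma_iff, Finset.coe_range, Set.mem_Iio,
      List.coe_toFinset, Set.mem_ofPred_eq, Nat.mem_bitIndices] at hq
    have hlt : v ^^^ 2 ^ i < v := by
      refine Nat.lt_of_testBit i ?_ hq.2 fun j hj => ?_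
      · simp [hq.2]
      · simp [Nat.testBit_two_pow_of_ne hj.ne]
    simp only [Finset.coe_filter, Finset.mem_product, Finset.mem_range, Set.mem_ofPred_eq]
    refine ⟨⟨hlt.trans hq.1, hq.1⟩, hlt, i, ?_⟩
    rw [Nat.xor_comm, Nat.xor_xor_cancel_left]
  · rintro ⟨v, i⟩ _ ⟨v', i'⟩ _ e
    simp only [Prod.mk.injEq] at e
    obtain ⟨e, rfl⟩ := e
    have := Nat.pow_right_injective le_rfl (Nat.xor_right_injective e)
    rw [this]

theorem interiorCount_foldedHypercube (s : ℕ) (S : Finset (Fin (2 ^ s))) :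
    interiorCount (foldedHypercube s) S =
      edgeCount (FoldedAdj s) (S.map Fin.valEmbedding) := by
  rw [interiorCount_eq_edgeCount]
  refine Finset.card_nbij (fun q => (q.1.val, q.2.val)) ?_ ?_ ?_
  · rintro ⟨u, v⟩ h
    simp only [Finset.coe_filter, Finset.mem_product, Set.mem_ofPred_eq, foldedHypercube,
      SimpleGraph.fromRel_adj, Nat.xor_comm v.val u.val, or_self] at h
    simp only [Finset.coe_filter, Finset.mem_product, Set.mem_ofPred_eq]
    refine ⟨⟨Finset.mem_map_of_mem _ h.1.1, Finset.mem_map_of_mem _ h.1.2⟩, h.2.1, ?_⟩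
    exact h.2.2.2.imp_left fun ⟨i, _, hi⟩ => ⟨i, hi⟩
  · rintro ⟨u, v⟩ _ ⟨u', v'⟩ _ e
    simpa [Fin.ext_iff] using e
  · rintro ⟨u, v⟩ h
    simp only [Finset.coe_filter, Finset.mem_product, Set.mem_ofPred_eq, Finset.mem_map] at h
    obtain ⟨⟨⟨u, hu, rfl⟩, v, hv, rfl⟩, hlt, hR⟩ := h
    refine ⟨(u, v), ?_, rfl⟩
    simp only [Finset.coe_filter, Finset.mem_product, Set.mem_ofPred_eq, foldedHypercube,
      SimpleGraph.fromRel_adj, Nat.xor_comm v.val u.val, or_self]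
    refine ⟨⟨hu, hv⟩, hlt, (Fin.lt_def.2 hlt).ne, hR.imp_left fun ⟨i, hi⟩ => ⟨i, ?_, hi⟩⟩
    have := Nat.xor_lt_two_pow u.isLt v.isLt
    rw [show u.val ^^^ v.val = 2 ^ i from hi] at this
    exact (Nat.pow_lt_pow_iff_right (by norm_num)).1 this

/-- There are no antipodal pairs inside a half of the folded hypercube. -/
theorem edgeCount_foldedAdj_le_cubeAdj {s c : ℕ} {S : Finset ℕ}
    (h : ∀ u ∈ S, u / 2 ^ s = c) :
    edgeCount (FoldedAdj (s + 1)) S ≤ edgeCount CubeAdj S := by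
  refine edgeCount_mono fun u hu v hv hR => hR.resolve_right fun hxor => ?_
  have h₁ : (u ^^^ v) / 2 ^ s = 0 := by
    rw [Nat.xor_div_two_pow, h u hu, h v hv, Nat.xor_self]
  rw [hxor, Nat.div_eq_zero_iff, pow_succ'] at h₁
  have := Nat.two_pow_pos s
  omega

theorem two_pow_add_two_sub_one_div (k : ℕ) : (2 ^ (k + 2) - 1) / 2 ^ k = 3 := by
  have := Nat.two_pow_pos k
  rw [pow_add, Nat.div_eq_iff this]
  omega

/-- Between two quarters of the folded hypercube, the edges form a matching. -/
theorem crossCount_foldedAdj_le_min {k a b : ℕ} {A B : Finset ℕ}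
    (hA : ∀ u ∈ A, u / 2 ^ k = a) (hB : ∀ u ∈ B, u / 2 ^ k = b)
    (hab : a ^^^ b = 2 ∨ a ^^^ b = 3) :
    crossCount (FoldedAdj (k + 2)) A B ≤ min A.card B.card := by
  rcases hab with hab | hab
  · refine crossCount_le_min (2 ^ (k + 1)) fun u hu v hv hR => ?_
    rcases hR with hR | hR
    · exact hR.xor_eq (by rw [hA u hu, hB v hv, hab, pow_one])
    · have := congrArg (· / 2 ^ k) hR
      simp only [Nat.xor_div_two_pow, hA u hu, hB v hv, hab, two_pow_add_two_sub_one_div] at this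
      omega
  · refine crossCount_le_min (2 ^ (k + 2) - 1) fun u hu v hv hR => ?_
    exact hR.resolve_left (not_cubeAdj_of_xor_div_eq_three (by rw [hA u hu, hB v hv, hab]))

/-- The two halves of an interval inside a half of the folded hypercube. -/
theorem exists_halves {k c x y : ℕ} (h : ∀ u ∈ Finset.Ico x y, u / 2 ^ (k + 1) = c) :
    ∃ A B : Finset ℕ, Finset.Ico x y = A ∪ B ∧ A.card + B.card = y - x ∧
      (∀ u ∈ A, u / 2 ^ k = 2 * c) ∧ (∀ u ∈ B, u / 2 ^ k = 2 * c + 1) ∧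
      A.card ≤ 2 ^ k ∧ B.card ≤ 2 ^ k ∧
      edgeCount (FoldedAdj (k + 2)) (Finset.Ico x y) ≤
        initialEdges A.card + initialEdges B.card + (A.card + B.card - 2 ^ k) := by
  have hpos := Nat.two_pow_pos k
  set A := (Finset.Ico x y).filter fun u => u / 2 ^ k = 2 * c with hA
  set B := (Finset.Ico x y).filter fun u => u / 2 ^ k = 2 * c + 1 with hB
  have hAB : Finset.Ico x y = A ∪ B := by
    ext u
    simp only [hA, hB, Finset.mem_union, Finset.mem_filter]
    have : u ∈ Finset.Ico x y → u / 2 ^ k = 2 * c ∨ u / 2 ^ k = 2 * c + 1 := fun hu => by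
      have := h u hu
      rw [pow_succ, ← Nat.div_div_eq_div_mul] at this
      omega
    tauto
  have hA' : ∀ u ∈ A, u / 2 ^ k = 2 * c := fun u hu => (Finset.mem_filter.1 hu).2
  have hB' : ∀ u ∈ B, u / 2 ^ k = 2 * c + 1 := fun u hu => (Finset.mem_filter.1 hu).2
  have hblock : ∀ (d : ℕ) (C : Finset ℕ), (∀ u ∈ C, u / 2 ^ k = d) → C.card ≤ 2 ^ k := by
    intro d C hC
    have : C ⊆ Finset.Ico (d * 2 ^ k) (d * 2 ^ k + 2 ^ k) := fun u hu => by
      have := (Nat.div_eq_iff hpos).1 (hC u hu)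
      rw [Finset.mem_Ico]
      omega
    simpa using Finset.card_le_card this
  have hlt : ∀ u ∈ A, ∀ v ∈ B, u < v := fun u hu v hv => by
    by_contra! hle
    have := Nat.div_le_div_right (c := 2 ^ k) hle
    rw [hA' u hu, hB' v hv] at this
    omega
  have hcard : A.card + B.card = y - x := by
    rw [← Nat.card_Ico, hAB]
    exact (Finset.card_union_of_disjoint
      (Finset.disjoint_left.2 fun u hu hu' => (hlt u hu u hu').false)).symm
  refine ⟨A, B, hAB, hcard, hA', hB', hblock _ _ hA', hblock _ _ hB', ?_⟩
  have h₁ : edgeCount (FoldedAdj (k + 2)) _ ≤ _ := edgeCount_foldedAdj_le_cubeAdj h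
  have h₂ := edgeCount_union_le CubeAdj hlt
  have h₃ := edgeCount_cubeAdj_le k _ A hA'
  have h₄ := edgeCount_cubeAdj_le k _ B hB'
  have h₅ := crossCount_cubeAdj_le_sub (hAB ▸ Finset.subset_union_left)
    (hAB ▸ Finset.subset_union_right) hA' hB'
  rw [← hAB] at h₂
  omega

theorem edgeCount_foldedAdj_Ico_union_le {k x₁ y₁ x₂ y₂ : ℕ}
    (h₁ : ∀ u ∈ Finset.Ico x₁ y₁, u / 2 ^ (k + 1) = 0)
    (h₂ : ∀ u ∈ Finset.Ico x₂ y₂, u / 2 ^ (k + 1) = 1)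
    (hp : (y₁ - x₁) + (y₂ - x₂) ≤ 2 ^ (k + 1)) :
    edgeCount (FoldedAdj (k + 2)) (Finset.Ico x₁ y₁ ∪ Finset.Ico x₂ y₂) ≤
      initialEdges ((y₁ - x₁) + (y₂ - x₂)) := by
  have hlt : ∀ u ∈ Finset.Ico x₁ y₁, ∀ v ∈ Finset.Ico x₂ y₂, u < v := fun u hu v hv => by
    by_contra! hle
    have := Nat.div_le_div_right (c := 2 ^ (k + 1)) hle
    rw [h₁ u hu, h₂ v hv] at this
    omega
  have hunion := edgeCount_union_le (FoldedAdj (k + 2)) hlt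
  obtain ⟨A₀, A₁, hA, hAc, hA₀, hA₁, hA₀c, hA₁c, hAe⟩ := exists_halves h₁
  obtain ⟨B₀, B₁, hB, hBc, hB₀, hB₁, hB₀c, hB₁c, hBe⟩ := exists_halves h₂
  have hcross : crossCount (FoldedAdj (k + 2)) (Finset.Ico x₁ y₁) (Finset.Ico x₂ y₂) ≤
      min A₀.card B₀.card + min A₁.card B₁.card + min A₀.card B₁.card +
        min A₁.card B₀.card := by
    rw [hA, hB]
    have e := crossCount_union_left_le (FoldedAdj (k + 2)) A₀ A₁ (B₀ ∪ B₁)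
    have e₀ := crossCount_union_right_le (FoldedAdj (k + 2)) A₀ B₀ B₁
    have e₁ := crossCount_union_right_le (FoldedAdj (k + 2)) A₁ B₀ B₁
    have f₀₀ := crossCount_foldedAdj_le_min hA₀ hB₀ (by decide)
    have f₀₁ := crossCount_foldedAdj_le_min hA₀ hB₁ (by decide)
    have f₁₀ := crossCount_foldedAdj_le_min hA₁ hB₀ (by decide)
    have f₁₁ := crossCount_foldedAdj_le_min hA₁ hB₁ (by decide)
    linarith
  rw [← hAc, ← hBc, pow_succ'] at hp
  have := initialEdges_four_cycle_add_le hA₀c hA₁c hB₀c hB₁c hp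
  rw [← hAc, ← hBc]
  linarith

theorem IsIntervalSet.exists_map_eq_Ico {s : ℕ} {P : Finset (Fin (2 ^ s))}
    (h : IsIntervalSet P) : ∃ x y : ℕ, P.map Fin.valEmbedding = Finset.Ico x y := by
  obtain ⟨a, b, h⟩ := h
  refine ⟨a, min b (2 ^ s), ?_⟩
  ext u
  simp only [Finset.mem_map, Fin.valEmbedding_apply, Finset.mem_Ico, lt_min_iff]
  constructor
  · rintro ⟨v, hv, rfl⟩
    exact ⟨((h v).1 hv).1, ((h v).1 hv).2, v.isLt⟩
  · rintro ⟨hau, hub, hus⟩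
    exact ⟨⟨u, hus⟩, (h _).2 ⟨hau, hub⟩, rfl⟩

theorem InOneSubcube.exists_div_eq {s : ℕ} {P : Finset (Fin (2 ^ (s + 1)))}
    (h : InOneSubcube P) :
    (∀ u ∈ P.map Fin.valEmbedding, u / 2 ^ s = 0) ∨
      ∀ u ∈ P.map Fin.valEmbedding, u / 2 ^ s = 1 := by
  simp only [Finset.mem_map, Fin.valEmbedding_apply, forall_exists_index, and_imp,
    forall_apply_eq_imp_iff₂]
  refine h.imp (fun h v hv => Nat.div_eq_of_lt (h v hv)) fun h v hv => ?_
  have h₁ := h v hv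
  have h₂ := v.isLt.trans_eq (pow_succ' 2 s)
  rw [Nat.add_sub_cancel] at h₁
  rw [Nat.div_eq_iff (Nat.two_pow_pos s)]
  omega

theorem edgeCount_foldedAdj_map_union_le {s : ℕ} {P₁ P₂ : Finset (Fin (2 ^ (s + 1)))}
    (hI₁ : IsIntervalSet P₁) (hI₂ : IsIntervalSet P₂)
    (h₁ : ∀ u ∈ P₁.map Fin.valEmbedding, u / 2 ^ s = 0)
    (h₂ : ∀ u ∈ P₂.map Fin.valEmbedding, u / 2 ^ s = 1)
    (hp : P₁.card + P₂.card ≤ 2 ^ s) :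
    edgeCount (FoldedAdj (s + 1)) (P₁.map Fin.valEmbedding ∪ P₂.map Fin.valEmbedding) ≤
      initialEdges (P₁.card + P₂.card) := by
  cases s with
  | zero =>
    refine le_of_eq_of_le (crossCount_eq_zero fun u hu v hv hR => hR.1.ne ?_) (Nat.zero_le _)
    refine Finset.card_le_one.1 ((Finset.card_union_le _ _).trans ?_) u hu v hv
    simpa using hp
  | succ k =>
    obtain ⟨x₁, y₁, e₁⟩ := hI₁.exists_map_eq_Ico
    obtain ⟨x₂, y₂, e₂⟩ := hI₂.exists_map_eq_Ico
    have c₁ := congrArg Finset.card e₁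
    have c₂ := congrArg Finset.card e₂
    rw [Finset.card_map, Nat.card_Ico] at c₁ c₂
    rw [e₁] at h₁ ⊢
    rw [e₂] at h₂ ⊢
    rw [c₁, c₂] at hp ⊢
    exact edgeCount_foldedAdj_Ico_union_le h₁ h₂ hp

/-- If `P₁`, `P₂` are disjoint intervals, each contained in one of the two
subcubes of `FQ^s`, with `|P₁| + |P₂| = p ≤ 2^{s−1}`, then `P₁ ∪ P₂` induces
at most as many edges of `FQ^s` as the initial segment `L_p`. -/
theorem foldedHypercube_interval_union_le (s p : ℕ) (hs : 1 ≤ s)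
    (hp : p ≤ 2 ^ (s - 1))
    (P₁ P₂ : Finset (Fin (2 ^ s)))
    (hI₁ : IsIntervalSet P₁) (hI₂ : IsIntervalSet P₂)
    (hC₁ : InOneSubcube P₁) (hC₂ : InOneSubcube P₂)
    (hdisj : Disjoint P₁ P₂)
    (hcard : P₁.card + P₂.card = p) :
    interiorCount (foldedHypercube s) (P₁ ∪ P₂) ≤
      interiorCount (foldedHypercube s)
        (Finset.univ.filter (fun v : Fin (2 ^ s) => v.val < p)) := by
  obtain ⟨s, rfl⟩ : ∃ t, s = t + 1 := ⟨s - 1, by omega⟩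
  rw [Nat.add_sub_cancel] at hp
  subst hcard
  have hrange : (Finset.univ.filter
      (fun v : Fin (2 ^ (s + 1)) => v.val < P₁.card + P₂.card)).map Fin.valEmbedding =
      Finset.range (P₁.card + P₂.card) := by
    ext u
    simp only [Finset.mem_map, Finset.mem_filter, Finset.mem_univ, true_and,
      Fin.valEmbedding_apply, Finset.mem_range]
    refine ⟨fun ⟨v, hv, e⟩ => e ▸ hv, fun hu => ⟨⟨u, ?_⟩, hu, rfl⟩⟩
    rw [pow_succ']
    omega
  rw [interiorCount_foldedHypercube, interiorCount_foldedHypercube, hrange]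
  refine le_trans ?_ ((initialEdges_le_edgeCount_range _).trans
    (edgeCount_mono fun _ _ _ _ => Or.inl))
  rw [Finset.map_union]
  have hsame : ∀ c, (∀ u ∈ P₁.map Fin.valEmbedding, u / 2 ^ s = c) →
      (∀ u ∈ P₂.map Fin.valEmbedding, u / 2 ^ s = c) →
      edgeCount (FoldedAdj (s + 1)) (P₁.map Fin.valEmbedding ∪ P₂.map Fin.valEmbedding) ≤
        initialEdges (P₁.card + P₂.card) := fun c h₁ h₂ => by
    rw [← Finset.card_union_of_disjoint hdisj, ← Finset.card_map Fin.valEmbedding,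
      Finset.map_union]
    have h := fun u hu => (Finset.mem_union.1 hu).elim (h₁ u) (h₂ u)
    exact (edgeCount_foldedAdj_le_cubeAdj h).trans (edgeCount_cubeAdj_le s c _ h)
  rcases hC₁.exists_div_eq with h₁ | h₁ <;> rcases hC₂.exists_div_eq with h₂ | h₂
  · exact hsame 0 h₁ h₂
  · exact edgeCount_foldedAdj_map_union_le hI₁ hI₂ h₁ h₂ hp
  · rw [Finset.union_comm, add_comm P₁.card]
    exact edgeCount_foldedAdj_map_union_le hI₂ hI₁ h₂ h₁ (by omega)
  · exact hsame 1 h₁ h₂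
end

section
/- Let s ≥ 3, let A = FQ^s be the s-dimensional folded hypercube, and let B = COL(4, 2^{s−3} − 1) be the cycle-of-ladders with 4 ladders each of length 2^{s−3} − 1 (so |V(A)| = |V(B)| = 2^s). Then WL(A, B) = 2^{s+2} + 4 · Σ_{j=1}^{2^{s−3} − 1} θ_A(2j). -/
open scoped Classical

/-- Number of edges of `G` with exactly one endpoint in `S`. -/
noncomputable def boundaryCount {V : Type*} [Fintype V] (G : SimpleGraph V)
    (S : Finset V) : ℕ :=
  (G.edgeFinset.filter (fun e => ∃ x y, e = s(x, y) ∧ x ∈ S ∧ y ∉ S)).card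

/-- `θ_G(m)`: minimum number of boundary edges over all `m`-subsets. -/
noncomputable def minCut {V : Type*} [Fintype V] (G : SimpleGraph V) (m : ℕ) : ℕ :=
  sInf {c | ∃ S : Finset V, S.card = m ∧ c = boundaryCount G S}

/-- The wirelength `WL(A,B)`: the minimum over all bijections `h` of the total
distance in `B` between the images of the endpoints of the edges of `A`. -/
noncomputable def wirelength {V W : Type*} [Fintype V] [Fintype W]
    (A : SimpleGraph V) (B : SimpleGraph W) : ℕ :=
  sInf {c | ∃ h : V ≃ W, c = ∑ e ∈ A.edgeFinset,
    Sym2.lift ⟨fun x y => B.dist (h x) (h y),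
      fun x y => SimpleGraph.dist_comm⟩ e}

/-- The cycle-of-ladders `COL(l,r)`: `l` ladders, each the product of a path on
`r+1` vertices with `K₂` (vertex `(i,a,b)` is the vertex of the `a`-th band of
the `i`-th ladder at height `b`), whose bottom rungs lie on a bone cycle of
length `2l`.  Edges: band edges `(i,a,b)–(i,a,b+1)`, rung edges
`(i,0,b)–(i,1,b)`, and bone-cycle edges `(i,1,0)–(i+1 mod l,0,0)`. -/
def cycleOfLadders (l r : ℕ) : SimpleGraph (Fin l × Bool × Fin (r + 1)) :=
  SimpleGraph.fromRel (fun u v =>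
    (u.1 = v.1 ∧ u.2.1 = v.2.1 ∧ u.2.2.val + 1 = v.2.2.val) ∨
    (u.1 = v.1 ∧ u.2.1 ≠ v.2.1 ∧ u.2.2 = v.2.2) ∨
    (u.2.1 = true ∧ v.2.1 = false ∧ u.2.2.val = 0 ∧ v.2.2.val = 0 ∧
      (u.1.val + 1) % l = v.1.val))

/-- The number of edges spanned by the first `m` vertices (in binary order) of a hypercube. -/
def cubeEdges : ℕ → ℕ
  | 0 => 0
  | 1 => 0
  | n + 2 => cubeEdges ((n + 2) / 2) + cubeEdges ((n + 3) / 2) + (n + 2) / 2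

theorem cubeEdges_two_mul (m : ℕ) : cubeEdges (2 * m) = 2 * cubeEdges m + m := by
  rcases m with _ | m
  · simp [cubeEdges]
  · rw [show 2 * (m + 1) = 2 * m + 2 by ring, cubeEdges,
      show (2 * m + 2) / 2 = m + 1 by omega, show (2 * m + 3) / 2 = m + 1 by omega]
    ring

theorem cubeEdges_two_mul_add_one (m : ℕ) :
    cubeEdges (2 * m + 1) = cubeEdges m + cubeEdges (m + 1) + m := by
  rcases m with _ | m
  · simp [cubeEdges]
  · rw [show 2 * (m + 1) + 1 = (2 * m + 1) + 2 by ring, cubeEdges,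
      show (2 * m + 1 + 2) / 2 = m + 1 by omega, show (2 * m + 1 + 3) / 2 = m + 1 + 1 by omega]

theorem cubeEdges_add_add_min_le (a b : ℕ) :
    cubeEdges a + cubeEdges b + min a b ≤ cubeEdges (a + b) := by
  induction hn : a + b using Nat.strong_induction_on generalizing a b with
  | _ n ih =>
    subst hn
    rcases Nat.eq_zero_or_pos a with rfl | ha
    · simp [cubeEdges]
    rcases Nat.eq_zero_or_pos b with rfl | hb
    · simp [cubeEdges]
    obtain ⟨a', rfl | rfl⟩ := Nat.even_or_odd' a <;> obtain ⟨b', rfl | rfl⟩ := Nat.even_or_odd' b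
    · have h := ih (a' + b') (by omega) a' b' rfl
      rw [← mul_add]
      simp only [cubeEdges_two_mul]
      omega
    · have h1 := ih (a' + b') (by omega) a' b' rfl
      have h2 := ih (a' + (b' + 1)) (by omega) a' (b' + 1) rfl
      rw [show 2 * a' + (2 * b' + 1) = 2 * (a' + b') + 1 by ring]
      simp only [cubeEdges_two_mul, cubeEdges_two_mul_add_one]
      rw [← add_assoc] at h2
      omega
    · have h1 := ih (a' + b') (by omega) a' b' rfl
      have h2 := ih (a' + 1 + b') (by omega) (a' + 1) b' rfl
      rw [show 2 * a' + 1 + 2 * b' = 2 * (a' + b') + 1 by ring]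
      simp only [cubeEdges_two_mul, cubeEdges_two_mul_add_one]
      rw [show a' + 1 + b' = a' + b' + 1 by ring] at h2
      omega
    · have h1 := ih (a' + (b' + 1)) (by omega) a' (b' + 1) rfl
      have h2 := ih (a' + 1 + b') (by omega) (a' + 1) b' rfl
      rw [show 2 * a' + 1 + (2 * b' + 1) = 2 * (a' + b' + 1) by ring]
      simp only [cubeEdges_two_mul, cubeEdges_two_mul_add_one]
      rw [show a' + 1 + b' = a' + b' + 1 by ring] at h2
      rw [← add_assoc] at h1
      omega

theorem cubeEdges_two_pow_add (k c : ℕ) (hc : c ≤ 2 ^ k) :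
    cubeEdges (2 ^ k + c) = cubeEdges (2 ^ k) + cubeEdges c + c := by
  induction k generalizing c with
  | zero =>
    have : c = 0 ∨ c = 1 := by simp at hc; omega
    rcases this with rfl | rfl <;> simp [cubeEdges]
  | succ k ih =>
    rw [pow_succ'] at hc ⊢
    obtain ⟨d, rfl | rfl⟩ := Nat.even_or_odd' c
    · rw [← mul_add]
      simp only [cubeEdges_two_mul, ih d (by omega)]
      ring
    · rw [show 2 * 2 ^ k + (2 * d + 1) = 2 * (2 ^ k + d) + 1 by ring]
      have h := ih (d + 1) (by omega)
      rw [← add_assoc] at h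
      simp only [cubeEdges_two_mul, cubeEdges_two_mul_add_one, ih d (by omega), h]
      ring

theorem two_mul_cubeEdges_compl (k a b : ℕ) (h : a + b = 2 ^ k) :
    2 * cubeEdges b + 2 * k * a = k * 2 ^ k + 2 * cubeEdges a := by
  induction k generalizing a b with
  | zero =>
    have : a = 0 ∧ b = 1 ∨ a = 1 ∧ b = 0 := by simp at h; omega
    rcases this with ⟨rfl, rfl⟩ | ⟨rfl, rfl⟩ <;> simp [cubeEdges]
  | succ k ih =>
    rw [pow_succ'] at h ⊢
    obtain ⟨d, rfl | rfl⟩ := Nat.even_or_odd' a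
    · obtain ⟨c, rfl⟩ : ∃ c, b = 2 * c := ⟨b / 2, by omega⟩
      have h1 := ih d c (by omega)
      simp only [cubeEdges_two_mul]
      have h2 : d + c = 2 ^ k := by omega
      rw [← h2] at h1 ⊢
      linarith
    · obtain ⟨c, rfl⟩ : ∃ c, b = 2 * c + 1 := ⟨b / 2, by omega⟩
      have h1 := ih d (c + 1) (by omega)
      have h3 := ih (d + 1) c (by omega)
      simp only [cubeEdges_two_mul_add_one]
      have h2 : d + c + 1 = 2 ^ k := by omega
      rw [← h2] at h1 h3 ⊢
      linarith

open Finset in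
/-- Number of ordered pairs of hypercube neighbours, weighted by `f`. -/
def cubeEnergy (k : ℕ) (f : ℕ → ℤ) : ℤ :=
  ∑ x ∈ range (2 ^ k), ∑ i ∈ range k, f x * f (x ^^^ 2 ^ i)

open Finset in
/-- Number of ordered antipodal pairs of hypercube vertices, weighted by `f`. -/
def antipodalEnergy (k : ℕ) (f : ℕ → ℤ) : ℤ :=
  ∑ x ∈ range (2 ^ k), f x * f (2 ^ k - 1 - x)

theorem two_pow_add_xor {k x i : ℕ} (hx : x < 2 ^ k) (hi : i < k) :
    (2 ^ k + x) ^^^ 2 ^ i = 2 ^ k + (x ^^^ 2 ^ i) := by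
  have h1 : x ^^^ 2 ^ i < 2 ^ k := Nat.xor_lt_two_pow hx (Nat.pow_lt_pow_right (by norm_num) hi)
  have e1 : ∀ y, y < 2 ^ k → 2 ^ k + y = 2 ^ k ^^^ y := by
    intro y hy
    apply Nat.eq_of_testBit_eq
    intro j
    rw [Nat.testBit_xor, Nat.testBit_two_pow]
    rcases lt_trichotomy j k with h | rfl | h
    · rw [Nat.testBit_two_pow_add_gt h]
      simp [h.ne']
    · rw [Nat.testBit_two_pow_add_eq]
      simp [Nat.testBit_lt_two_pow hy]
    · have h3 : 2 ^ (k + 1) ≤ 2 ^ j := Nat.pow_le_pow_right (by norm_num) h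
      rw [Nat.testBit_lt_two_pow (by rw [pow_succ] at h3; omega),
        Nat.testBit_lt_two_pow (by rw [pow_succ] at h3; omega)]
      simp [h.ne]
  rw [e1 _ hx, e1 _ h1, Nat.xor_assoc]

theorem xor_two_pow_self {k x : ℕ} (hx : x < 2 ^ k) : x ^^^ 2 ^ k = 2 ^ k + x := by
  apply Nat.eq_of_testBit_eq
  intro j
  rw [Nat.testBit_xor, Nat.testBit_two_pow]
  rcases lt_trichotomy j k with h | rfl | h
  · rw [Nat.testBit_two_pow_add_gt h]
    simp [h.ne']
  · rw [Nat.testBit_two_pow_add_eq]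
    simp [Nat.testBit_lt_two_pow hx]
  · have h3 : 2 ^ (k + 1) ≤ 2 ^ j := Nat.pow_le_pow_right (by norm_num) h
    rw [Nat.testBit_lt_two_pow (by rw [pow_succ] at h3; omega),
      Nat.testBit_lt_two_pow (by rw [pow_succ] at h3; omega)]
    simp [h.ne]

theorem xor_two_pow_lt {k x i : ℕ} (hx : x < 2 ^ k) (hi : i < k) : x ^^^ 2 ^ i < 2 ^ k :=
  Nat.xor_lt_two_pow hx (Nat.pow_lt_pow_right (by norm_num) hi)

open Finset in
theorem sum_range_two_pow_succ (k : ℕ) (f : ℕ → ℤ) :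
    ∑ x ∈ range (2 ^ (k + 1)), f x = ∑ x ∈ range (2 ^ k), (f x + f (2 ^ k + x)) := by
  rw [pow_succ, mul_two, sum_range_add, sum_add_distrib]

open Finset in
theorem sum_xor (k i : ℕ) (hi : i < k) (f : ℕ → ℤ) :
    ∑ x ∈ range (2 ^ k), f (x ^^^ 2 ^ i) = ∑ x ∈ range (2 ^ k), f x := by
  apply sum_nbij' (fun x => x ^^^ 2 ^ i) (fun x => x ^^^ 2 ^ i)
  · intro x hx; simpa using xor_two_pow_lt (by simpa using hx) hi
  · intro x hx; simpa using xor_two_pow_lt (by simpa using hx) hi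
  · intro x _; simp
  · intro x _; simp
  · intro x _; rfl

open Finset in
theorem sum_antipode (k : ℕ) (f : ℕ → ℤ) :
    ∑ x ∈ range (2 ^ k), f (2 ^ k - 1 - x) = ∑ x ∈ range (2 ^ k), f x :=
  sum_range_reflect f (2 ^ k)

open Finset in
theorem cubeEnergy_succ (k : ℕ) (f : ℕ → ℤ) :
    cubeEnergy (k + 1) f = cubeEnergy k f + cubeEnergy k (fun x => f (2 ^ k + x)) +
      2 * ∑ x ∈ range (2 ^ k), f x * f (2 ^ k + x) := by
  unfold cubeEnergy
  rw [sum_range_two_pow_succ, mul_sum, ← sum_add_distrib, ← sum_add_distrib]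
  refine sum_congr rfl fun x hx => ?_
  have hx : x < 2 ^ k := by simpa using hx
  rw [sum_range_succ, sum_range_succ, xor_two_pow_self hx]
  have h1 : (2 ^ k + x) ^^^ 2 ^ k = x := by
    rw [← xor_two_pow_self hx, Nat.xor_assoc]; simp
  rw [h1]
  have h2 : ∑ i ∈ range k, f (2 ^ k + x) * f ((2 ^ k + x) ^^^ 2 ^ i) =
      ∑ i ∈ range k, f (2 ^ k + x) * f (2 ^ k + (x ^^^ 2 ^ i)) :=
    sum_congr rfl fun i hi => by rw [two_pow_add_xor hx (by simpa using hi)]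
  rw [h2]
  ring

open Finset in
theorem antipodalEnergy_succ (k : ℕ) (f : ℕ → ℤ) :
    antipodalEnergy (k + 1) f =
      2 * ∑ x ∈ range (2 ^ k), f x * f (2 ^ k + (2 ^ k - 1 - x)) := by
  unfold antipodalEnergy
  rw [sum_range_two_pow_succ, sum_add_distrib, two_mul]
  congr 1
  · refine sum_congr rfl fun x hx => ?_
    have hx : x < 2 ^ k := by simpa using hx
    congr 2
    rw [pow_succ]; omega
  · rw [← sum_antipode]
    refine sum_congr rfl fun x hx => ?_
    have hx : x < 2 ^ k := by simpa using hx
    rw [mul_comm]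
    congr 2
    rw [pow_succ]; omega

open Finset in
theorem cubeEnergy_one_sub (k : ℕ) (f : ℕ → ℤ) :
    cubeEnergy k (fun x => 1 - f x) =
      k * 2 ^ k - 2 * k * ∑ x ∈ range (2 ^ k), f x + cubeEnergy k f := by
  unfold cubeEnergy
  have h : ∀ x i, (1 - f x) * (1 - f (x ^^^ 2 ^ i)) =
      1 - f x - f (x ^^^ 2 ^ i) + f x * f (x ^^^ 2 ^ i) := fun x i => by ring
  simp only [h, sum_add_distrib, sum_sub_distrib]
  have h2 : ∑ x ∈ range (2 ^ k), ∑ i ∈ range k, f (x ^^^ 2 ^ i) =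
      k * ∑ x ∈ range (2 ^ k), f x := by
    rw [sum_comm, sum_congr rfl fun i hi => sum_xor k i (by simpa using hi) f]
    simp
  rw [h2]
  simp [← mul_sum]
  ring

open Finset in
theorem antipodalEnergy_one_sub (k : ℕ) (f : ℕ → ℤ) :
    antipodalEnergy k (fun x => 1 - f x) =
      2 ^ k - 2 * ∑ x ∈ range (2 ^ k), f x + antipodalEnergy k f := by
  unfold antipodalEnergy
  have h : ∀ x, (1 - f x) * (1 - f (2 ^ k - 1 - x)) =
      1 - f x - f (2 ^ k - 1 - x) + f x * f (2 ^ k - 1 - x) := fun x => by ring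
  simp only [h, sum_add_distrib, sum_sub_distrib, sum_antipode]
  simp
  ring

open Finset in
theorem sum_mul_le_sum_right {n : ℕ} {g h : ℕ → ℤ} (hg : ∀ x, g x = 0 ∨ g x = 1)
    (hh : ∀ x, h x = 0 ∨ h x = 1) :
    ∑ x ∈ range n, g x * h x ≤ ∑ x ∈ range n, h x := by
  refine sum_le_sum fun x _ => ?_
  rcases hg x with h1 | h1 <;> rcases hh x with h2 | h2 <;> simp [h1, h2]

open Finset in
theorem sum_range_nonneg_int {n : ℕ} {f : ℕ → ℤ} (hf : ∀ x, f x = 0 ∨ f x = 1) :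
    0 ≤ ∑ x ∈ range n, f x :=
  sum_nonneg fun x _ => by rcases hf x with h | h <;> simp [h]

open Finset in
/-- The edge-isoperimetric inequality in the hypercube. -/
theorem cubeEnergy_le (k : ℕ) (f : ℕ → ℤ) (hf : ∀ x, f x = 0 ∨ f x = 1) (m : ℕ)
    (hm : ∑ x ∈ range (2 ^ k), f x = m) : cubeEnergy k f ≤ 2 * cubeEdges m := by
  induction k generalizing f m with
  | zero => simp [cubeEnergy]
  | succ k ih =>
    have hf1 : ∀ x, f (2 ^ k + x) = 0 ∨ f (2 ^ k + x) = 1 := fun x => hf _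
    obtain ⟨a, ha⟩ := Int.eq_ofNat_of_zero_le (sum_range_nonneg_int (n := 2 ^ k) hf)
    obtain ⟨b, hb⟩ := Int.eq_ofNat_of_zero_le (sum_range_nonneg_int (n := 2 ^ k) hf1)
    rw [sum_range_two_pow_succ, sum_add_distrib, ha, hb] at hm
    have hm : a + b = m := by exact_mod_cast hm
    have h1 := ih f hf a ha
    have h2 := ih _ hf1 b hb
    have h3 := sum_mul_le_sum_right (n := 2 ^ k) hf hf1
    have h4 := sum_mul_le_sum_right (n := 2 ^ k) hf1 hf
    simp only [mul_comm (f (2 ^ k + _))] at h4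
    have h5 := cubeEdges_add_add_min_le a b
    rw [hm] at h5
    rw [cubeEnergy_succ]
    omega

open Finset in
theorem two_mul_cross_le (k : ℕ) {g h : ℕ → ℤ} (hg : ∀ x, g x = 0 ∨ g x = 1)
    (hh : ∀ x, h x = 0 ∨ h x = 1) :
    2 * (∑ x ∈ range (2 ^ k), g x * h x + ∑ x ∈ range (2 ^ k), g x * h (2 ^ k - 1 - x)) ≤
      2 * ∑ x ∈ range (2 ^ k), h x + antipodalEnergy k g + antipodalEnergy k h := by
  have e1 := sum_antipode k h
  have e2 := sum_antipode k (fun x => g x * h x)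
  have e3 := sum_antipode k (fun x => g x * h (2 ^ k - 1 - x))
  have e4 : ∑ x ∈ range (2 ^ k), g (2 ^ k - 1 - x) * h (2 ^ k - 1 - (2 ^ k - 1 - x)) =
      ∑ x ∈ range (2 ^ k), g (2 ^ k - 1 - x) * h x := by
    refine sum_congr rfl fun x hx => ?_
    have hx : x < 2 ^ k := by simpa using hx
    congr 2
    omega
  rw [e4] at e3
  have key : ∑ x ∈ range (2 ^ k), (g x * h x + g (2 ^ k - 1 - x) * h (2 ^ k - 1 - x) +
      g x * h (2 ^ k - 1 - x) + g (2 ^ k - 1 - x) * h x) ≤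
      ∑ x ∈ range (2 ^ k), (h x + h (2 ^ k - 1 - x) + g x * g (2 ^ k - 1 - x) +
        h x * h (2 ^ k - 1 - x)) := by
    refine sum_le_sum fun x _ => ?_
    rcases hg x with h1 | h1 <;> rcases hh x with h2 | h2 <;>
      rcases hg (2 ^ k - 1 - x) with h3 | h3 <;> rcases hh (2 ^ k - 1 - x) with h4 | h4 <;>
      simp [h1, h2, h3, h4]
  simp only [sum_add_distrib] at key
  unfold antipodalEnergy
  linarith

open Finset in
theorem folded_step (k : ℕ)
    (ih : ∀ (f : ℕ → ℤ), (∀ x, f x = 0 ∨ f x = 1) → ∀ m : ℕ,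
      ∑ x ∈ range (2 ^ (k + 1)), f x = m → m ≤ 2 ^ k →
        cubeEnergy (k + 1) f + antipodalEnergy (k + 1) f ≤ 2 * cubeEdges m)
    {g h : ℕ → ℤ} (hg : ∀ x, g x = 0 ∨ g x = 1) (hh : ∀ x, h x = 0 ∨ h x = 1) {a b : ℕ}
    (ha : ∑ x ∈ range (2 ^ (k + 1)), g x = a) (hb : ∑ x ∈ range (2 ^ (k + 1)), h x = b)
    (hba : b ≤ a) (hab : a + b ≤ 2 ^ (k + 1)) :
    cubeEnergy (k + 1) g + cubeEnergy (k + 1) h +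
      2 * (∑ x ∈ range (2 ^ (k + 1)), g x * h x +
        ∑ x ∈ range (2 ^ (k + 1)), g x * h (2 ^ (k + 1) - 1 - x)) ≤ 2 * cubeEdges (a + b) := by
  have hpow : 2 ^ (k + 1) = 2 * 2 ^ k := pow_succ' 2 k
  have hcross := two_mul_cross_le (k + 1) hg hh
  have hhb := ih h hh b hb (by omega)
  have hsuper := cubeEdges_add_add_min_le a b
  rw [hb] at hcross
  rcases le_or_gt a (2 ^ k) with hak | hak
  · have hga := ih g hg a ha hak
    omega
  · obtain ⟨c, rfl⟩ : ∃ c, a = 2 ^ k + c := ⟨a - 2 ^ k, by omega⟩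
    have h1 := cubeEdges_two_pow_add k c (by omega)
    have h2 := cubeEdges_two_pow_add k (c + b) (by omega)
    have h3 := cubeEdges_add_add_min_le c b
    rw [← add_assoc] at h2
    rcases le_or_gt b c with hbc | hbc
    · have q1 := cubeEnergy_le (k + 1) g hg _ ha
      have q2 := cubeEnergy_le (k + 1) h hh _ hb
      have q3 := sum_mul_le_sum_right (n := 2 ^ (k + 1)) hg hh
      have q4 := sum_mul_le_sum_right (n := 2 ^ (k + 1)) (h := fun x => h (2 ^ (k + 1) - 1 - x))
        hg (fun x => hh _)
      rw [sum_antipode, hb] at q4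
      omega
    · obtain ⟨d, hd⟩ : ∃ d, 2 ^ k + c + d = 2 ^ (k + 1) := ⟨2 ^ (k + 1) - (2 ^ k + c), by omega⟩
      have hd' : c + d = 2 ^ k := by omega
      have q1 := ih (fun x => 1 - g x) (fun x => by rcases hg x with h | h <;> simp [h]) d
        (by
          rw [sum_sub_distrib, ha]
          simp only [sum_const, card_range, mul_one, nsmul_eq_mul]
          rw [← hd]; push_cast; ring) (by omega)
      rw [cubeEnergy_one_sub, antipodalEnergy_one_sub, ha] at q1
      have q2 := two_mul_cubeEdges_compl (k + 1) (2 ^ k + c) d hd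
      zify at q2 h1 h2 h3 hd' hbc
      have hpz : (2 : ℤ) ^ (k + 1) = 2 * 2 ^ k := pow_succ' 2 k
      have q3 : cubeEnergy (k + 1) g + antipodalEnergy (k + 1) g ≤
          2 * cubeEdges (2 ^ k + c) + 2 * c := by
        push_cast at q1 q2 ⊢
        rw [hpz] at q1 q2
        linarith
      rw [min_eq_left hbc.le] at h3
      linarith

open Finset in
/-- The edge-isoperimetric inequality in the folded hypercube. -/
theorem cubeEnergy_add_antipodalEnergy_le (k : ℕ) (f : ℕ → ℤ) (hf : ∀ x, f x = 0 ∨ f x = 1)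
    (m : ℕ) (hm : ∑ x ∈ range (2 ^ (k + 1)), f x = m) (hmk : m ≤ 2 ^ k) :
    cubeEnergy (k + 1) f + antipodalEnergy (k + 1) f ≤ 2 * cubeEdges m := by
  induction k generalizing f m with
  | zero =>
    rw [cubeEnergy_succ, antipodalEnergy_succ]
    rw [sum_range_two_pow_succ] at hm
    simp only [cubeEnergy, pow_zero, range_one, sum_singleton, add_zero, range_zero, sum_empty]
      at hm hmk ⊢
    have : (m : ℤ) ≤ 1 := by exact_mod_cast hmk
    rcases hf 0 with h0 | h0 <;> rcases hf 1 with h1 | h1 <;> simp [h0, h1] at hm ⊢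
    omega
  | succ k ih =>
    have hf1 : ∀ x, f (2 ^ (k + 1) + x) = 0 ∨ f (2 ^ (k + 1) + x) = 1 := fun x => hf _
    obtain ⟨a, ha⟩ := Int.eq_ofNat_of_zero_le (sum_range_nonneg_int (n := 2 ^ (k + 1)) hf)
    obtain ⟨b, hb⟩ := Int.eq_ofNat_of_zero_le (sum_range_nonneg_int (n := 2 ^ (k + 1)) hf1)
    rw [sum_range_two_pow_succ, sum_add_distrib, ha, hb] at hm
    have hm : a + b = m := by exact_mod_cast hm
    subst hm
    rw [cubeEnergy_succ, antipodalEnergy_succ]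
    rcases le_total b a with hba | hba
    · have := folded_step k ih hf hf1 ha hb hba hmk
      linarith
    · have h1 := folded_step k ih hf1 hf hb ha hba (by omega)
      have h2 : ∑ x ∈ range (2 ^ (k + 1)), f (2 ^ (k + 1) + x) * f (2 ^ (k + 1) - 1 - x) =
          ∑ x ∈ range (2 ^ (k + 1)), f x * f (2 ^ (k + 1) + (2 ^ (k + 1) - 1 - x)) := by
        rw [← sum_antipode]
        refine sum_congr rfl fun x hx => ?_
        have hx : x < 2 ^ (k + 1) := by simpa using hx
        rw [mul_comm]
        congr 2
        omega
      rw [h2, add_comm b a] at h1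
      simp only [mul_comm (f (2 ^ (k + 1) + _)) (f _)] at h1
      linarith

open Finset in
theorem cubeEnergy_nonneg (k : ℕ) {f : ℕ → ℤ} (hf : ∀ x, 0 ≤ f x) : 0 ≤ cubeEnergy k f :=
  sum_nonneg fun _ _ => sum_nonneg fun _ _ => mul_nonneg (hf _) (hf _)

open Finset in
/-- Initial segments in binary order are optimal in the hypercube. -/
theorem le_cubeEnergy_of_initial (k m : ℕ) (hm : m ≤ 2 ^ k) (f : ℕ → ℤ)
    (hf : ∀ x, f x = 0 ∨ f x = 1) (h : ∀ x < 2 ^ k, x < m → f x = 1) :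
    2 * cubeEdges m ≤ cubeEnergy k f := by
  have hf0 : ∀ x, 0 ≤ f x := fun x => by rcases hf x with h | h <;> simp [h]
  induction k generalizing f m with
  | zero =>
    have : m = 0 ∨ m = 1 := by simp at hm; omega
    rcases this with rfl | rfl <;> simp [cubeEdges, cubeEnergy]
  | succ k ih =>
    have hpow : 2 ^ (k + 1) = 2 * 2 ^ k := pow_succ' 2 k
    rw [cubeEnergy_succ]
    rcases le_or_gt m (2 ^ k) with hmk | hmk
    · have h1 := ih m hmk f hf (fun x hx hxm => h x (by omega) hxm) hf0
      have h2 := cubeEnergy_nonneg k (f := fun x => f (2 ^ k + x)) (fun x => hf0 _)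
      have h3 : 0 ≤ ∑ x ∈ range (2 ^ k), f x * f (2 ^ k + x) :=
        sum_nonneg fun _ _ => mul_nonneg (hf0 _) (hf0 _)
      linarith
    · obtain ⟨c, rfl⟩ : ∃ c, m = 2 ^ k + c := ⟨m - 2 ^ k, by omega⟩
      have h1 := ih (2 ^ k) le_rfl f hf (fun x hx _ => h x (by omega) (by omega)) hf0
      have h2 := ih c (by omega) (fun x => f (2 ^ k + x)) (fun x => hf _)
        (fun x hx hxm => h _ (by omega) (by omega)) (fun x => hf0 _)
      have h3 : (c : ℤ) ≤ ∑ x ∈ range (2 ^ k), f x * f (2 ^ k + x) := by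
        calc (c : ℤ) = ∑ x ∈ range c, f x * f (2 ^ k + x) := by
              rw [sum_congr rfl (g := fun _ => (1 : ℤ))]
              · simp
              · intro x hx
                have hx : x < c := by simpa using hx
                rw [h x (by omega) (by omega), h (2 ^ k + x) (by omega) (by omega), mul_one]
          _ ≤ _ := sum_le_sum_of_subset_of_nonneg (range_subset_range.2 (by omega))
              fun _ _ _ => mul_nonneg (hf0 _) (hf0 _)
      rw [cubeEdges_two_pow_add k c (by omega)]
      push_cast
      linarith

open Finset in
theorem SimpleGraph.two_mul_sum_edgeFinset {V : Type*} [Fintype V] (G : SimpleGraph V)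
    (F : Sym2 V → ℤ) :
    2 * ∑ e ∈ G.edgeFinset, F e = ∑ x, ∑ y with G.Adj x y, F s(x, y) := by
  have h1 : ∑ d : G.Dart, F d.edge = 2 * ∑ e ∈ G.edgeFinset, F e := by
    rw [← sum_fiberwise_of_maps_to (s := univ) (t := G.edgeFinset) (g := SimpleGraph.Dart.edge)
      (fun d _ => by rw [SimpleGraph.mem_edgeFinset]; exact d.edge_mem), mul_sum]
    refine sum_congr rfl fun e he => ?_
    rw [sum_congr rfl (g := fun _ => F e) (fun d hd => by rw [(mem_filter.1 hd).2]), sum_const,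
      G.dart_edge_fiber_card e (SimpleGraph.mem_edgeFinset.1 he)]
    simp
  rw [← h1, sum_sigma']
  refine sum_bij' (fun d _ => ⟨d.fst, d.snd⟩)
    (fun p hp => ⟨(p.1, p.2), by simpa using hp⟩) ?_ ?_ ?_ ?_ ?_
  · intro d _; simp
  · intros; simp
  · intros; rfl
  · intros; rfl
  · intros; rfl

theorem xor_two_pow_sub_one {s x : ℕ} (hx : x < 2 ^ s) : x ^^^ (2 ^ s - 1) = 2 ^ s - 1 - x := by
  apply Nat.eq_of_testBit_eq
  intro j
  rw [Nat.testBit_xor, Nat.testBit_two_pow_sub_one, Nat.sub_sub, add_comm 1 x,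
    Nat.testBit_two_pow_sub_succ hx]
  by_cases hj : j < s
  · simp [hj]
  · have : x < 2 ^ j := hx.trans_le (Nat.pow_le_pow_right (by norm_num) (by omega))
    simp [hj, Nat.testBit_lt_two_pow this]

theorem foldedHypercube_adj {s : ℕ} (hs : 1 ≤ s) (u v : Fin (2 ^ s)) :
    (foldedHypercube s).Adj u v ↔
      (∃ i < s, u.val ^^^ v.val = 2 ^ i) ∨ u.val ^^^ v.val = 2 ^ s - 1 := by
  unfold foldedHypercube
  rw [SimpleGraph.fromRel_adj, Nat.xor_comm v.val u.val, or_self]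
  refine and_iff_right_of_imp ?_
  rintro h rfl
  rw [Nat.xor_self] at h
  rcases h with ⟨i, -, h⟩ | h
  · exact absurd h (by positivity)
  · have : 2 ^ 1 ≤ 2 ^ s := Nat.pow_le_pow_right (by norm_num) hs
    omega

open Finset in
theorem foldedHypercube_neighbors_map {s : ℕ} (hs : 1 ≤ s) (u : Fin (2 ^ s)) :
    ({v | (foldedHypercube s).Adj u v} : Finset _).map Fin.valEmbedding =
      insert (2 ^ s - 1 - u.val) ((range s).image fun i => u.val ^^^ 2 ^ i) := by
  have key : ∀ a b c : ℕ, a ^^^ b = c ↔ a ^^^ c = b := fun a b c => by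
    constructor <;> rintro rfl <;> simp
  ext y
  simp only [mem_map, mem_filter, mem_univ, true_and, foldedHypercube_adj hs, mem_insert,
    mem_image, mem_range, Fin.valEmbedding_apply, ← xor_two_pow_sub_one u.isLt]
  constructor
  · rintro ⟨v, ⟨i, hi, h⟩ | h, rfl⟩
    · exact Or.inr ⟨i, hi, (key _ _ _).1 h⟩
    · exact Or.inl ((key _ _ _).1 h).symm
  · rintro (rfl | ⟨i, hi, rfl⟩)
    · have h : u.val ^^^ (2 ^ s - 1) < 2 ^ s := by rw [xor_two_pow_sub_one u.isLt]; omega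
      exact ⟨⟨_, h⟩, Or.inr (by simp), rfl⟩
    · exact ⟨⟨_, xor_two_pow_lt u.isLt hi⟩, Or.inl ⟨i, hi, by simp⟩, rfl⟩

open Finset in
theorem two_mul_sum_foldedHypercube {s : ℕ} (hs : 2 ≤ s) (F : Sym2 (Fin (2 ^ s)) → ℤ)
    (w : ℕ → ℕ → ℤ) (hw : ∀ x y : Fin (2 ^ s), F s(x, y) = w x y) :
    2 * ∑ e ∈ (foldedHypercube s).edgeFinset, F e =
      ∑ x ∈ range (2 ^ s), (∑ i ∈ range s, w x (x ^^^ 2 ^ i) + w x (2 ^ s - 1 - x)) := by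
  rw [SimpleGraph.two_mul_sum_edgeFinset, ← Fin.sum_univ_eq_sum_range
    (fun x => ∑ i ∈ range s, w x (x ^^^ 2 ^ i) + w x (2 ^ s - 1 - x))]
  refine sum_congr rfl fun u _ => ?_
  have h1 : ∑ v with (foldedHypercube s).Adj u v, F s(u, v) =
      ∑ y ∈ ({v | (foldedHypercube s).Adj u v} : Finset _).map Fin.valEmbedding, w u y := by
    rw [sum_map]
    exact sum_congr rfl fun v _ => hw u v
  rw [h1, foldedHypercube_neighbors_map (by omega), sum_insert, sum_image, add_comm]
  · intro i _ j _ h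
    exact Nat.pow_right_injective le_rfl (Nat.xor_right_injective h)
  · simp only [mem_image, mem_range, not_exists, not_and, ← xor_two_pow_sub_one u.isLt]
    intro i hi h
    have h := Nat.xor_right_injective h
    have hlast : Nat.testBit (2 ^ s - 1) (if i = 0 then 1 else 0) = true := by
      rw [Nat.testBit_two_pow_sub_one]; split_ifs <;> simp <;> omega
    rw [← h, Nat.testBit_two_pow, decide_eq_true_eq] at hlast
    split_ifs at hlast <;> omega

/-- The `0`-`1` valued separation of the two endpoints of an edge by a two-colouring. -/
def separation {V : Type*} (σ : V → Bool) : Sym2 V → ℕ :=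
  Sym2.lift ⟨fun x y => if σ x = σ y then 0 else 1, fun x y => by simp only [eq_comm]⟩

open Finset in
theorem boundaryCount_eq_sum_separation {V : Type*} [Fintype V] (G : SimpleGraph V) (σ : V → Bool) :
    boundaryCount G {x | σ x = true} = ∑ e ∈ G.edgeFinset, separation σ e := by
  unfold boundaryCount
  rw [card_filter]
  refine sum_congr rfl fun e _ => ?_
  induction e using Sym2.ind with
  | _ x y =>
    have : (∃ x' y', s(x, y) = s(x', y') ∧ x' ∈ ({x | σ x = true} : Finset V) ∧
        y' ∉ ({x | σ x = true} : Finset V)) ↔ ¬ σ x = σ y := by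
      simp only [mem_filter, mem_univ, true_and]
      constructor
      · rintro ⟨x', y', h, h1, h2⟩ h3
        rcases Sym2.eq_iff.1 h with ⟨rfl, rfl⟩ | ⟨rfl, rfl⟩ <;> simp_all
      · intro h
        by_cases hx : σ x = true
        · exact ⟨x, y, rfl, hx, fun hy => h (hx.trans hy.symm)⟩
        · refine ⟨y, x, Sym2.eq_swap, ?_, hx⟩
          by_contra hy
          simp_all
    simp only [this, separation, Sym2.lift_mk]
    split_ifs <;> simp_all

open Finset in
theorem boundaryCount_foldedHypercube {s : ℕ} (hs : 2 ≤ s) (S : Finset (Fin (2 ^ s)))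
    (f : ℕ → ℤ) (hf : ∀ x : Fin (2 ^ s), f x = if x ∈ S then 1 else 0) :
    (boundaryCount (foldedHypercube s) S : ℤ) =
      (s + 1) * S.card - (cubeEnergy s f + antipodalEnergy s f) := by
  have hS : S = ({x | decide (x ∈ S) = true} : Finset _) := by ext; simp
  have hcard : ∑ x ∈ range (2 ^ s), f x = S.card := by
    rw [← Fin.sum_univ_eq_sum_range]
    simp [hf]
  have h := two_mul_sum_foldedHypercube hs
    (fun e => (separation (fun x => decide (x ∈ S)) e : ℤ))
    (fun x y => f x + f y - 2 * (f x * f y)) (fun x y => by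
      simp only [separation, Sym2.lift_mk, hf]
      by_cases hx : x ∈ S <;> by_cases hy : y ∈ S <;> simp [hx, hy])
  have hE : ∑ x ∈ range (2 ^ s), f x * ∑ i ∈ range s, f (x ^^^ 2 ^ i) = cubeEnergy s f := by
    simp only [cubeEnergy, mul_sum]
  rw [← Nat.cast_sum, ← boundaryCount_eq_sum_separation, ← hS] at h
  simp only [sum_add_distrib, sum_sub_distrib, ← mul_sum] at h
  rw [sum_antipode, sum_comm (f := fun x i => f (x ^^^ 2 ^ i)),
    sum_congr rfl fun i hi => sum_xor s i (by simpa using hi) f] at h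
  simp only [sum_const, card_range, hcard, nsmul_eq_mul] at h
  rw [← mul_sum, hcard, hE] at h
  unfold antipodalEnergy
  linarith

open Finset in
theorem le_boundaryCount_foldedHypercube {s m : ℕ} (hs : 2 ≤ s) (S : Finset (Fin (2 ^ s)))
    (hS : S.card = m) (hm : 2 * m ≤ 2 ^ s) :
    (s + 1) * m ≤ boundaryCount (foldedHypercube s) S + 2 * cubeEdges m := by
  obtain ⟨k, rfl⟩ : ∃ k, s = k + 1 := ⟨s - 1, by omega⟩
  let f : ℕ → ℤ := fun x => if x ∈ S.map Fin.valEmbedding then 1 else 0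
  have hf : ∀ x : Fin (2 ^ (k + 1)), f x = if x ∈ S then 1 else 0 := fun x => by
    simp [f, Fin.val_inj]
  have h1 := boundaryCount_foldedHypercube hs S f hf
  have h2 := cubeEnergy_add_antipodalEnergy_le k f (fun x => by simp only [f]; split_ifs <;> simp) m
    (by rw [← Fin.sum_univ_eq_sum_range]; simp [hf, hS]) (by rw [pow_succ'] at hm; omega)
  rw [hS] at h1
  zify
  push_cast at h1 ⊢
  linarith

theorem two_pow_le_boundaryCount_foldedHypercube {k : ℕ} (hk : 1 ≤ k)
    (S : Finset (Fin (2 ^ (k + 1)))) (hS : S.card = 2 ^ k) :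
    2 ^ (k + 1) ≤ boundaryCount (foldedHypercube (k + 1)) S := by
  have h1 := le_boundaryCount_foldedHypercube (by omega) S hS (by rw [pow_succ'])
  have h2 := two_mul_cubeEdges_compl k 0 (2 ^ k) (by simp)
  simp only [cubeEdges] at h2
  have h3 : 2 ^ (k + 1) = 2 * 2 ^ k := pow_succ' 2 k
  linarith

/-- The side of the `c`-th antipodal cut of the bone cycle of `COL(4, r)`. -/
def boneSide (c : Fin 4) (p : Fin 4 × Bool) : Bool :=
  decide (c.val + 1 ≤ 2 * p.1.val + p.2.toNat ∧ 2 * p.1.val + p.2.toNat ≤ c.val + 4)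

/-- Distance on the bone cycle of `COL(4, r)`. -/
def boneDist (p q : Fin 4 × Bool) : ℕ :=
  ∑ c : Fin 4, if boneSide c p = boneSide c q then 0 else 1

/-- The height of a vertex in the `i`-th ladder (zero outside of it). -/
def ladderHeight {r : ℕ} (i : Fin 4) (v : Fin 4 × Bool × Fin (r + 1)) : ℕ :=
  if v.1 = i then v.2.2.val else 0

/-- Number of tail cuts and bone cuts of `COL(4, r)` separating two vertices. -/
def separatingCuts {r : ℕ} (u v : Fin 4 × Bool × Fin (r + 1)) : ℕ :=
  (∑ i : Fin 4, ∑ c ∈ Finset.range r,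
    if decide (c < ladderHeight i u) = decide (c < ladderHeight i v) then 0 else 1) +
  boneDist (u.1, u.2.1) (v.1, v.2.1)

theorem sum_range_threshold (r m n : ℕ) (hm : m ≤ r) (hn : n ≤ r) :
    (∑ c ∈ Finset.range r, if decide (c < m) = decide (c < n) then 0 else 1) =
      (m - n) + (n - m) := by
  have h : ∀ c, (if decide (c < m) = decide (c < n) then 0 else 1) =
      if ¬ (c < m ↔ c < n) then 1 else 0 := by
    intro c; by_cases h1 : c < m <;> by_cases h2 : c < n <;> simp [h1, h2]
  simp only [h]
  rw [← Finset.card_filter]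
  have : (Finset.range r).filter (fun c => ¬ (c < m ↔ c < n)) =
      Finset.Ico (min m n) (max m n) := by
    ext c
    simp only [Finset.mem_filter, Finset.mem_range, Finset.mem_Ico]
    omega
  rw [this, Nat.card_Ico]
  omega

theorem separatingCuts_eq {r : ℕ} (i j : Fin 4) (a a' : Bool) (b b' : Fin (r + 1)) :
    separatingCuts (i, a, b) (j, a', b') =
      (if i = j then (b.val - b'.val) + (b'.val - b.val) else b.val + b'.val) +
        boneDist (i, a) (j, a') := by
  unfold separatingCuts
  congr 1
  have hb := b.is_le
  have hb' := b'.is_le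
  rw [Finset.sum_congr rfl fun c _ => sum_range_threshold r _ _
    (by unfold ladderHeight; split_ifs <;> simp [hb]) (by unfold ladderHeight; split_ifs <;> simp [hb'])]
  rw [Fin.sum_univ_four]
  unfold ladderHeight
  fin_cases i <;> fin_cases j <;> simp <;> omega

theorem separatingCuts_self {r : ℕ} (u : Fin 4 × Bool × Fin (r + 1)) : separatingCuts u u = 0 := by
  simp [separatingCuts, boneDist]

theorem separatingCuts_comm {r : ℕ} (u v : Fin 4 × Bool × Fin (r + 1)) :
    separatingCuts u v = separatingCuts v u := by
  simp only [separatingCuts, boneDist, eq_comm]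

theorem ite_eq_triangle (a b c : Bool) :
    (if a = c then 0 else 1) ≤ (if a = b then 0 else 1) + (if b = c then 0 else 1) := by
  revert a b c; decide

theorem separatingCuts_triangle {r : ℕ} (u v w : Fin 4 × Bool × Fin (r + 1)) :
    separatingCuts u w ≤ separatingCuts u v + separatingCuts v w := by
  unfold separatingCuts boneDist
  rw [add_add_add_comm]
  simp only [← Finset.sum_add_distrib]
  gcongr <;> apply ite_eq_triangle

theorem cycleOfLadders_adj_bone {r : ℕ} {p q : Fin 4 × Bool} (b : Fin (r + 1)) (hb : b.val = 0)
    (h : boneDist p q = 1) :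
    (cycleOfLadders 4 r).Adj (p.1, p.2, b) (q.1, q.2, b) := by
  have key : ∀ p q : Fin 4 × Bool, boneDist p q = 1 →
      p ≠ q ∧ ((p.1 = q.1 ∧ p.2 ≠ q.2) ∨
        (p.2 = true ∧ q.2 = false ∧ (p.1.val + 1) % 4 = q.1.val) ∨
        (q.2 = true ∧ p.2 = false ∧ (q.1.val + 1) % 4 = p.1.val)) := by decide
  obtain ⟨h1, h2⟩ := key p q h
  unfold cycleOfLadders
  rw [SimpleGraph.fromRel_adj]
  refine ⟨fun h => h1 (Prod.ext (congrArg (·.1) h) (congrArg (·.2.1) h)), ?_⟩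
  rcases h2 with ⟨h3, h4⟩ | ⟨h3, h4, h5⟩ | ⟨h3, h4, h5⟩
  · exact Or.inl (Or.inr (Or.inl ⟨h3, h4, rfl⟩))
  · exact Or.inl (Or.inr (Or.inr ⟨h3, h4, hb, hb, h5⟩))
  · exact Or.inr (Or.inr (Or.inr ⟨h3, h4, hb, hb, h5⟩))

theorem separatingCuts_le_one_of_adj {r : ℕ} {u v : Fin 4 × Bool × Fin (r + 1)}
    (h : (cycleOfLadders 4 r).Adj u v) : separatingCuts u v ≤ 1 := by
  have rung : ∀ i a a', boneDist (i, a) (i, a') ≤ 1 := by decide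
  have bone : ∀ i j : Fin 4, (i.val + 1) % 4 = j.val →
      i ≠ j ∧ boneDist (i, true) (j, false) ≤ 1 := by decide
  have self : ∀ p, boneDist p p = 0 := by decide
  unfold cycleOfLadders at h
  rw [SimpleGraph.fromRel_adj] at h
  obtain ⟨-, h⟩ := h
  wlog h' : ((u.1 = v.1 ∧ u.2.1 = v.2.1 ∧ u.2.2.val + 1 = v.2.2.val) ∨
    (u.1 = v.1 ∧ u.2.1 ≠ v.2.1 ∧ u.2.2 = v.2.2) ∨
    (u.2.1 = true ∧ v.2.1 = false ∧ u.2.2.val = 0 ∧ v.2.2.val = 0 ∧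
      (u.1.val + 1) % 4 = v.1.val)) generalizing u v
  · rw [separatingCuts_comm]
    exact this h.symm (h.resolve_left h')
  obtain ⟨i, a, b⟩ := u
  obtain ⟨j, a', b'⟩ := v
  rw [separatingCuts_eq]
  simp only at h'
  rcases h' with ⟨rfl, rfl, h1⟩ | ⟨rfl, -, rfl⟩ | ⟨rfl, rfl, h1, h2, h3⟩
  · rw [if_pos rfl, self]; omega
  · rw [if_pos rfl]; have := rung i a a'; omega
  · have := bone i j h3
    rw [if_neg this.1]; omega

theorem exists_adj_separatingCuts_lt {r : ℕ} {u v : Fin 4 × Bool × Fin (r + 1)} (huv : u ≠ v) :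
    ∃ u', (cycleOfLadders 4 r).Adj u u' ∧ separatingCuts u' v + 1 ≤ separatingCuts u v := by
  obtain ⟨i, a, b⟩ := u
  obtain ⟨j, a', b'⟩ := v
  have rung : ∀ i a a', a ≠ a' → boneDist (i, a) (i, a') = 1 ∧ boneDist (i, a') (i, a') = 0 := by
    decide
  have cyc : ∀ p q : Fin 4 × Bool, p ≠ q → ∃ p', boneDist p p' = 1 ∧
    boneDist p' q + 1 = boneDist p q := by decide
  by_cases hij : i = j
  · subst hij
    by_cases hb : b = b'
    · subst hb
      have ha : a ≠ a' := fun h => huv (by rw [h])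
      refine ⟨(i, a', b), ?_, ?_⟩
      · unfold cycleOfLadders
        rw [SimpleGraph.fromRel_adj]
        exact ⟨huv, Or.inl (Or.inr (Or.inl ⟨rfl, ha, rfl⟩))⟩
      · simp only [separatingCuts_eq, if_true]
        have := rung i a a' ha
        omega
    · rcases lt_or_gt_of_ne (fun h => hb (Fin.ext h) : b.val ≠ b'.val) with h | h
      · refine ⟨(i, a, ⟨b.val + 1, by omega⟩), ?_, ?_⟩
        · unfold cycleOfLadders
          rw [SimpleGraph.fromRel_adj]
          refine ⟨by simp [Fin.ext_iff], Or.inl (Or.inl ⟨rfl, rfl, rfl⟩)⟩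
        · simp only [separatingCuts_eq, if_true]
          omega
      · refine ⟨(i, a, ⟨b.val - 1, by omega⟩), ?_, ?_⟩
        · unfold cycleOfLadders
          rw [SimpleGraph.fromRel_adj]
          refine ⟨by simp [Fin.ext_iff]; omega, Or.inr (Or.inl ⟨rfl, rfl, ?_⟩)⟩
          show b.val - 1 + 1 = b.val
          omega
        · simp only [separatingCuts_eq, if_true]
          omega
  · rcases Nat.eq_zero_or_pos b.val with hb | hb
    · obtain ⟨p', h1, h2⟩ := cyc (i, a) (j, a') (fun h => hij (congrArg Prod.fst h))
      refine ⟨(p'.1, p'.2, b), cycleOfLadders_adj_bone b hb h1, ?_⟩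
      simp only [separatingCuts_eq, if_neg hij, hb]
      rw [Prod.mk.eta]
      split_ifs <;> omega
    · refine ⟨(i, a, ⟨b.val - 1, by omega⟩), ?_, ?_⟩
      · unfold cycleOfLadders
        rw [SimpleGraph.fromRel_adj]
        refine ⟨by simp [Fin.ext_iff]; omega, Or.inr (Or.inl ⟨rfl, rfl, ?_⟩)⟩
        show b.val - 1 + 1 = b.val
        omega
      · simp only [separatingCuts_eq, if_neg hij]
        omega

theorem exists_walk_length_le_separatingCuts {r : ℕ} (u v : Fin 4 × Bool × Fin (r + 1)) :
    ∃ p : (cycleOfLadders 4 r).Walk u v, p.length ≤ separatingCuts u v := by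
  induction hn : separatingCuts u v using Nat.strong_induction_on generalizing u with
  | _ n ih =>
    subst hn
    by_cases huv : u = v
    · subst huv
      exact ⟨.nil, by simp⟩
    · obtain ⟨u', hadj, hlt⟩ := exists_adj_separatingCuts_lt huv
      obtain ⟨p, hp⟩ := ih _ (by omega) u' rfl
      exact ⟨.cons hadj p, by rw [SimpleGraph.Walk.length_cons]; omega⟩

theorem separatingCuts_le_length {r : ℕ} {u v : Fin 4 × Bool × Fin (r + 1)}
    (p : (cycleOfLadders 4 r).Walk u v) : separatingCuts u v ≤ p.length := by
  induction p with
  | nil => simp [separatingCuts_self]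
  | @cons u w v h p ih =>
    have h1 := separatingCuts_triangle u w v
    have h2 := separatingCuts_le_one_of_adj h
    rw [SimpleGraph.Walk.length_cons]
    omega

theorem cycleOfLadders_dist {r : ℕ} (u v : Fin 4 × Bool × Fin (r + 1)) :
    (cycleOfLadders 4 r).dist u v = separatingCuts u v := by
  obtain ⟨p, hp⟩ := exists_walk_length_le_separatingCuts u v
  refine le_antisymm ((SimpleGraph.dist_le p).trans hp) ?_
  obtain ⟨q, hq⟩ := p.reachable.exists_walk_length_eq_dist
  rw [← hq]
  exact separatingCuts_le_length q

open Finset in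
theorem sum_dist_cycleOfLadders {V : Type*} [Fintype V] (A : SimpleGraph V) {r : ℕ}
    (h : V ≃ Fin 4 × Bool × Fin (r + 1)) :
    ∑ e ∈ A.edgeFinset, Sym2.lift ⟨fun x y => (cycleOfLadders 4 r).dist (h x) (h y),
      fun _ _ => SimpleGraph.dist_comm⟩ e =
    (∑ i : Fin 4, ∑ c ∈ range r,
      boundaryCount A {x | decide (c < ladderHeight i (h x)) = true}) +
    ∑ c : Fin 4, boundaryCount A {x | boneSide c ((h x).1, (h x).2.1) = true} := by
  simp only [boundaryCount_eq_sum_separation]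
  simp only [sum_comm (t := A.edgeFinset)]
  rw [← sum_add_distrib]
  refine sum_congr rfl fun e _ => ?_
  induction e using Sym2.ind with
  | _ x y => simp only [Sym2.lift_mk, cycleOfLadders_dist, separatingCuts, boneDist, separation]

open Finset in
theorem card_ladderHeight_gt {r : ℕ} (i : Fin 4) (c : ℕ) :
    #{v : Fin 4 × Bool × Fin (r + 1) | decide (c < ladderHeight i v) = true} = 2 * (r - c) := by
  have h : #{b : Fin (r + 1) | c < b.val} = r - c := by
    rw [← card_map Fin.valEmbedding]
    have : ({b : Fin (r + 1) | c < b.val} : Finset _).map Fin.valEmbedding = Ioc c r := by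
      ext y
      simp only [mem_map, mem_filter, mem_univ, true_and, Fin.valEmbedding_apply, mem_Ioc]
      exact ⟨fun ⟨b, h1, h2⟩ => by omega, fun h => ⟨⟨y, by omega⟩, h.1, rfl⟩⟩
    rw [this, Nat.card_Ioc]
  have h2 : ({v : Fin 4 × Bool × Fin (r + 1) | decide (c < ladderHeight i v) = true} : Finset _) =
      {i} ×ˢ (univ ×ˢ ({b : Fin (r + 1) | c < b.val} : Finset _)) := by
    ext ⟨j, a, b⟩
    rw [mem_filter]
    by_cases hj : j = i
    · simp [ladderHeight, hj]
    · simp [ladderHeight, hj, Ne.symm hj]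
  rw [h2, card_product, card_product, h]
  simp

open Finset in
theorem card_boneSide {r : ℕ} (c : Fin 4) :
    #{v : Fin 4 × Bool × Fin (r + 1) | boneSide c (v.1, v.2.1) = true} = 4 * (r + 1) := by
  have h : ∀ c, #{p : Fin 4 × Bool | boneSide c p = true} = 4 := by decide
  rw [← card_map (Equiv.prodAssoc (Fin 4) Bool (Fin (r + 1))).symm.toEmbedding]
  have h2 : ({v : Fin 4 × Bool × Fin (r + 1) | boneSide c (v.1, v.2.1) = true} : Finset _).map
      (Equiv.prodAssoc (Fin 4) Bool (Fin (r + 1))).symm.toEmbedding =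
      ({p : Fin 4 × Bool | boneSide c p = true} : Finset _) ×ˢ univ := by
    ext ⟨⟨j, a⟩, b⟩
    simp
  rw [h2, card_product, h]
  simp

open Finset in
theorem card_filter_comp_equiv {V W : Type*} [Fintype V] [Fintype W] (h : V ≃ W) (σ : W → Bool) :
    #{x | σ (h x) = true} = #{v | σ v = true} :=
  card_bij (fun x _ => h x) (by simp) (fun _ _ _ _ hxy => h.injective hxy)
    (fun v hv => ⟨h.symm v, by simpa using hv, by simp⟩)

/-- The Gray code labelling of the four ladders of `COL(4, r)`. -/
def grayLadder : Bool → Bool → Fin 4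
  | false, false => 0
  | false, true => 1
  | true, true => 2
  | true, false => 3

/-- The position on the bone cycle at the bottom of the image of a hypercube vertex. -/
def boneIndex (k x : ℕ) : Fin 4 × Bool :=
  (grayLadder (x.testBit (k + 2)) (x.testBit (k + 1)), x.testBit 0)

/-- An optimal embedding of the folded hypercube into `COL(4, r)`. -/
def ladderEmbedding (k r x : ℕ) : Fin 4 × Bool × Fin (r + 1) :=
  ((boneIndex k x).1, (boneIndex k x).2, ⟨r - x % 2 ^ (k + 1) / 2, by omega⟩)

theorem ladderEmbedding_injOn {k r : ℕ} (hr : r + 1 = 2 ^ k) {x y : ℕ} (hx : x < 2 ^ (k + 3))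
    (hy : y < 2 ^ (k + 3)) (h : ladderEmbedding k r x = ladderEmbedding k r y) : x = y := by
  have hgray : ∀ a b c d, grayLadder a b = grayLadder c d → a = c ∧ b = d := by decide
  simp only [ladderEmbedding, boneIndex, Prod.mk.injEq, Fin.mk.injEq] at h
  obtain ⟨h1, h2, h3⟩ := h
  obtain ⟨h4, h5⟩ := hgray _ _ _ _ h1
  have hpow : 2 ^ (k + 1) = 2 * 2 ^ k := pow_succ' 2 k
  have hxm := Nat.mod_lt x (show 2 ^ (k + 1) > 0 by positivity)
  have hym := Nat.mod_lt y (show 2 ^ (k + 1) > 0 by positivity)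
  have h6 : x % 2 = y % 2 := by
    simp only [Nat.testBit_zero] at h2
    have := decide_eq_decide.1 h2
    omega
  have hx2 : x % 2 ^ (k + 1) % 2 = x % 2 := Nat.mod_mod_of_dvd _ ⟨2 ^ k, hpow⟩
  have hy2 : y % 2 ^ (k + 1) % 2 = y % 2 := Nat.mod_mod_of_dvd _ ⟨2 ^ k, hpow⟩
  have h7 : x % 2 ^ (k + 1) = y % 2 ^ (k + 1) := by omega
  apply Nat.eq_of_testBit_eq
  intro j
  rcases lt_or_ge j (k + 1) with hj | hj
  · have := congrArg (fun z => Nat.testBit z j) h7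
    simpa [Nat.testBit_mod_two_pow, hj] using this
  · rcases lt_or_ge j (k + 3) with hj' | hj'
    · have : j = k + 1 ∨ j = k + 2 := by omega
      rcases this with rfl | rfl <;> assumption
    · rw [Nat.testBit_lt_two_pow (hx.trans_le (Nat.pow_le_pow_right (by norm_num) hj')),
        Nat.testBit_lt_two_pow (hy.trans_le (Nat.pow_le_pow_right (by norm_num) hj'))]

theorem ladderEmbedding_bijective {k r : ℕ} (hr : r + 1 = 2 ^ k) :
    Function.Bijective (fun x : Fin (2 ^ (k + 3)) => ladderEmbedding k r x) := by
  rw [Fintype.bijective_iff_injective_and_card]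
  refine ⟨fun x y h => Fin.ext (ladderEmbedding_injOn hr x.isLt y.isLt h), ?_⟩
  simp only [Fintype.card_fin, Fintype.card_prod, Fintype.card_bool, hr]
  ring

theorem cubeEnergy_half_le (k : ℕ) (b : Bool) {f : ℕ → ℤ} (hf : ∀ x, 0 ≤ f x) :
    cubeEnergy k (fun x => f (b.toNat * 2 ^ k + x)) ≤ cubeEnergy (k + 1) f := by
  have h1 := cubeEnergy_nonneg k hf
  have h2 := cubeEnergy_nonneg k (f := fun x => f (2 ^ k + x)) (fun x => hf _)
  have h3 : 0 ≤ ∑ x ∈ Finset.range (2 ^ k), f x * f (2 ^ k + x) :=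
    Finset.sum_nonneg fun _ _ => mul_nonneg (hf _) (hf _)
  rw [cubeEnergy_succ]
  cases b
  · simp; linarith
  · simp; linarith

theorem testBit_toNat_mul_two_pow_add (b : Bool) {k x : ℕ} (hx : x < 2 ^ k) :
    (b.toNat * 2 ^ k + x).testBit k = b := by
  cases b
  · simp [Nat.testBit_lt_two_pow hx]
  · simp [Nat.testBit_two_pow_add_eq, Nat.testBit_lt_two_pow hx]

open Finset in
theorem boundaryCount_ladderEmbedding_tail {k r : ℕ} (hr : r + 1 = 2 ^ k) (i : Fin 4) (c : ℕ)
    (S : Finset (Fin (2 ^ (k + 3))))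
    (hS : ∀ x, x ∈ S ↔ c < ladderHeight i (ladderEmbedding k r x))
    (hcard : S.card = 2 * (r - c)) :
    boundaryCount (foldedHypercube (k + 3)) S + 2 * cubeEdges (2 * (r - c)) ≤
      (k + 3 + 1) * (2 * (r - c)) := by
  let f : ℕ → ℤ := fun x => if c < ladderHeight i (ladderEmbedding k r x) then 1 else 0
  have hf01 : ∀ x, f x = 0 ∨ f x = 1 := fun x => by simp only [f]; split_ifs <;> simp
  have hf0 : ∀ x, 0 ≤ f x := fun x => by rcases hf01 x with h | h <;> simp [h]
  have h1 := boundaryCount_foldedHypercube (s := k + 3) (by omega) S f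
    (fun x => by simp only [f, hS])
  have hA : 0 ≤ antipodalEnergy (k + 3) f :=
    sum_nonneg fun _ _ => mul_nonneg (hf0 _) (hf0 _)
  obtain ⟨y, z, rfl⟩ : ∃ y z, grayLadder y z = i :=
    (by decide : ∀ i, ∃ y z, grayLadder y z = i) i
  have h2 := cubeEnergy_half_le (k + 2) y hf0
  have h3 := cubeEnergy_half_le (k + 1) z (f := fun x => f (y.toNat * 2 ^ (k + 2) + x))
    (fun x => hf0 _)
  have hpow : 2 ^ (k + 1) = 2 * 2 ^ k := pow_succ' 2 k
  have hpow' : 2 ^ (k + 2) = 2 * 2 ^ (k + 1) := pow_succ' 2 (k + 1)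
  have h4 := le_cubeEnergy_of_initial (k + 1) (2 * (r - c)) (by omega)
    (fun x => f (y.toNat * 2 ^ (k + 2) + (z.toNat * 2 ^ (k + 1) + x))) (fun x => hf01 _) (by
      intro x hx hxc
      have hz : z.toNat * 2 ^ (k + 1) + x < 2 ^ (k + 2) := by cases z <;> simp <;> omega
      have t1 := testBit_toNat_mul_two_pow_add y hz
      have t2 : (y.toNat * 2 ^ (k + 2) + (z.toNat * 2 ^ (k + 1) + x)).testBit (k + 1) = z := by
        refine Eq.trans ?_ (testBit_toNat_mul_two_pow_add z hx)
        cases y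
        · rw [Bool.toNat_false, zero_mul, zero_add]
        · simp only [Bool.toNat_true, one_mul]
          rw [Nat.testBit_two_pow_add_gt (by omega)]
      have t3 : (y.toNat * 2 ^ (k + 2) + (z.toNat * 2 ^ (k + 1) + x)) % 2 ^ (k + 1) = x := by
        rw [hpow', show y.toNat * (2 * 2 ^ (k + 1)) + (z.toNat * 2 ^ (k + 1) + x) =
          x + 2 ^ (k + 1) * (2 * y.toNat + z.toNat) by ring, Nat.add_mul_mod_self_left,
          Nat.mod_eq_of_lt hx]
      simp only [f]
      rw [if_pos]
      simp only [ladderHeight, ladderEmbedding, boneIndex, t1, t2, t3, if_true]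
      omega)
  rw [hcard] at h1
  zify
  push_cast at h1 h4 ⊢
  linarith

theorem boneDist_self (p : Fin 4 × Bool) : boneDist p p = 0 := by
  simp [boneDist]

open Finset in
theorem sum_boneDist_boneIndex (k x : ℕ) (hx : x < 2 ^ (k + 3)) :
    ∑ i ∈ range (k + 3), boneDist (boneIndex k x) (boneIndex k (x ^^^ 2 ^ i)) +
      boneDist (boneIndex k x) (boneIndex k (2 ^ (k + 3) - 1 - x)) = 8 := by
  have key : ∀ a b c, boneDist (grayLadder a b, c) (grayLadder a b, !c) = 1 ∧
      boneDist (grayLadder a b, c) (grayLadder a (!b), c) = 2 ∧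
      boneDist (grayLadder a b, c) (grayLadder (!a) b, c) = 2 ∧
      boneDist (grayLadder a b, c) (grayLadder (!a) (!b), !c) = 3 := by decide
  obtain ⟨k1, k2, k3, k4⟩ := key (x.testBit (k + 2)) (x.testBit (k + 1)) (x.testBit 0)
  rw [sum_range_succ, sum_range_succ, sum_range_succ', sum_eq_zero]
  · have e1 : boneDist (boneIndex k x) (boneIndex k (x ^^^ 2 ^ 0)) = 1 := by
      refine Eq.trans ?_ k1
      simp only [boneIndex, Nat.testBit_xor, Nat.testBit_two_pow]
      simp [-Nat.testBit_zero]
    have e2 : boneDist (boneIndex k x) (boneIndex k (x ^^^ 2 ^ (k + 1))) = 2 := by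
      refine Eq.trans ?_ k2
      simp only [boneIndex, Nat.testBit_xor, Nat.testBit_two_pow]
      simp [-Nat.testBit_zero]
    have e3 : boneDist (boneIndex k x) (boneIndex k (x ^^^ 2 ^ (k + 2))) = 2 := by
      refine Eq.trans ?_ k3
      simp only [boneIndex, Nat.testBit_xor, Nat.testBit_two_pow]
      simp [-Nat.testBit_zero]
    have e4 : boneDist (boneIndex k x) (boneIndex k (2 ^ (k + 3) - 1 - x)) = 3 := by
      refine Eq.trans ?_ k4
      simp only [boneIndex, Nat.sub_sub, add_comm 1 x, Nat.testBit_two_pow_sub_succ hx]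
      simp [-Nat.testBit_zero]
    rw [e1, e2, e3, e4]
  · intro i hi
    have hi : i < k := by simpa using hi
    have : boneIndex k (x ^^^ 2 ^ (i + 1)) = boneIndex k x := by
      simp only [boneIndex, Nat.testBit_xor, Nat.testBit_two_pow]
      have h1 : i ≠ k + 1 := by omega
      have h2 : i ≠ k := by omega
      simp [h1, h2]
    rw [this, boneDist_self]

open Finset in
theorem sum_boundaryCount_bone (k r : ℕ) :
    ∑ c : Fin 4, boundaryCount (foldedHypercube (k + 3))
      {x | boneSide c ((ladderEmbedding k r x).1, (ladderEmbedding k r x).2.1) = true} =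
    2 ^ (k + 3 + 2) := by
  simp only [boundaryCount_eq_sum_separation]
  rw [sum_comm]
  have h := two_mul_sum_foldedHypercube (s := k + 3) (by omega)
    (fun e => ((∑ c : Fin 4, separation (fun x : Fin (2 ^ (k + 3)) =>
      boneSide c ((ladderEmbedding k r x).1, (ladderEmbedding k r x).2.1)) e : ℕ) : ℤ))
    (fun x y => (boneDist (boneIndex k x) (boneIndex k y) : ℕ)) (fun x y => by
      simp only [separation, Sym2.lift_mk, ladderEmbedding, boneDist, Prod.mk.eta])
  have h2 : ∀ x ∈ range (2 ^ (k + 3)),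
      ∑ i ∈ range (k + 3), (boneDist (boneIndex k x) (boneIndex k (x ^^^ 2 ^ i)) : ℤ) +
      (boneDist (boneIndex k x) (boneIndex k (2 ^ (k + 3) - 1 - x)) : ℤ) = 8 := fun x hx => by
    exact_mod_cast sum_boneDist_boneIndex k x (by simpa using hx)
  rw [sum_congr rfl h2] at h
  simp only [sum_const, card_range, nsmul_eq_mul] at h
  have h3 : 2 ^ (k + 3 + 2) = 4 * 2 ^ (k + 3) := by ring
  rw [h3]
  zify
  push_cast at h
  linarith

open Finset in
theorem sum_range_minCut_eq (g : ℕ → ℕ) (r : ℕ) :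
    ∑ _i : Fin 4, ∑ c ∈ range r, g (2 * (r - c)) = 4 * ∑ j ∈ Icc 1 r, g (2 * j) := by
  have : ∑ c ∈ range r, g (2 * (r - c)) = ∑ j ∈ Icc 1 r, g (2 * j) := by
    refine sum_nbij' (fun c => r - c) (fun j => r - j) ?_ ?_ ?_ ?_ ?_ <;>
      intro c hc <;> simp only [mem_range, mem_Icc] at * <;> omega
  rw [this]
  simp

/-- **Theorem.** For `s ≥ 3`, the wirelength of embedding the folded hypercube
`FQ^s` into the cycle-of-ladders `COL(4, 2^{s−3} − 1)` is
`2^{s+2} + 4 ∑_{j=1}^{2^{s−3}−1} θ_{FQ^s}(2j)`. -/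
theorem wirelength_foldedHypercube_cycleOfLadders (s : ℕ) (hs : 3 ≤ s) :
    wirelength (foldedHypercube s) (cycleOfLadders 4 (2 ^ (s - 3) - 1)) =
      2 ^ (s + 2) +
        4 * ∑ j ∈ Finset.Icc 1 (2 ^ (s - 3) - 1), minCut (foldedHypercube s) (2 * j) := by
  obtain ⟨k, rfl⟩ : ∃ k, s = k + 3 := ⟨s - 3, by omega⟩
  rw [Nat.add_sub_cancel]
  obtain ⟨r, hr⟩ : ∃ r, r + 1 = 2 ^ k := ⟨2 ^ k - 1, Nat.sub_add_cancel Nat.one_le_two_pow⟩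
  rw [show 2 ^ k - 1 = r by omega, ← sum_range_minCut_eq]
  have hpow : 2 ^ (k + 3) = 8 * 2 ^ k := by ring
  let h₀ : Fin (2 ^ (k + 3)) ≃ Fin 4 × Bool × Fin (r + 1) :=
    Equiv.ofBijective _ (ladderEmbedding_bijective hr)
  unfold wirelength
  apply le_antisymm
  · refine le_trans (Nat.sInf_le ⟨h₀, rfl⟩) ?_
    rw [sum_dist_cycleOfLadders, add_comm]
    gcongr with i _ c hc
    · exact (sum_boundaryCount_bone k r).le
    · have hcard := (card_filter_comp_equiv h₀ fun v => decide (c < ladderHeight i v)).trans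
        (card_ladderHeight_gt i c)
      have hle := boundaryCount_ladderEmbedding_tail hr i c _ (fun x => by simp [h₀]) hcard
      unfold minCut
      refine le_csInf ⟨_, _, hcard, rfl⟩ ?_
      rintro _ ⟨S, hS, rfl⟩
      have := le_boundaryCount_foldedHypercube (by omega) S hS (by omega)
      omega
  · refine le_csInf ⟨_, h₀, rfl⟩ ?_
    rintro _ ⟨h, rfl⟩
    rw [sum_dist_cycleOfLadders, add_comm]
    refine add_le_add ?_ ?_
    · gcongr with i _ c hc
      exact Nat.sInf_le ⟨_, (card_filter_comp_equiv h fun v => decide (c < ladderHeight i v)).trans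
        (card_ladderHeight_gt i c), rfl⟩
    · have hb : ∀ c : Fin 4, 2 ^ (k + 3) ≤ boundaryCount (foldedHypercube (k + 3))
          {x | boneSide c ((h x).1, (h x).2.1) = true} := fun c =>
        two_pow_le_boundaryCount_foldedHypercube (k := k + 2) (by omega) _
          ((card_filter_comp_equiv h fun v => boneSide c (v.1, v.2.1)).trans
            ((card_boneSide c).trans (by rw [hr]; ring)))
      calc 2 ^ (k + 3 + 2) = ∑ _c : Fin 4, 2 ^ (k + 3) := by simp; ring
        _ ≤ _ := Finset.sum_le_sum fun c _ => hb c
end
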